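/- arXiv:1710.04757 — 2 statements merged into one kernel-verified Lean document; each statement's English description precedes it below -/
import Mathlib

section
/- For every integer a ≥ 1, the complete multipartite graph with 2a−1 parts of cardinality a and one part of cardinality 2a can be decomposed into a² edge-disjoint Hamilton paths. -/
open SimpleGraph

/-- A decomposition of `G` into `t` edge-disjoint Hamilton paths: a family of `t`
Hamiltonian paths of `G` such that every edge of `G` lies on exactly one of them. -/
def SimpleGraph.HamiltonianPathDecomposition {V : Type*} [DecidableEq V]
    (G : SimpleGraph V) (t : ℕ) : Prop :=
  ∃ (u v : Fin t → V) (p : ∀ i, G.Walk (u i) (v i)),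
    (∀ i, (p i).IsHamiltonian) ∧
    (∀ e ∈ G.edgeSet, ∃! i, e ∈ (p i).edges)

namespace HPD

/-- Multiset of edges of a list regarded as an open walk. -/
def pe {V : Type*} : List V → Multiset (Sym2 V)
  | [] => 0
  | [_] => 0
  | x :: y :: l => s(x, y) ::ₘ pe (y :: l)

/-- Multiset of edges of a list regarded as a closed walk. -/
def ce {V : Type*} : List V → Multiset (Sym2 V)
  | [] => 0
  | x :: l => pe (x :: (l ++ [x]))

lemma pe_append {V : Type*} (l₁ : List V) (u : V) (l₂ : List V) :
    pe (l₁ ++ u :: l₂) = pe (l₁ ++ [u]) + pe (u :: l₂) := by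
  induction l₁ with
  | nil => simp [pe]
  | cons x t ih =>
    cases t with
    | nil => simp [pe]
    | cons y t => simp only [List.cons_append, pe, Multiset.cons_add] at ih ⊢; rw [ih]

lemma pe_reverse {V : Type*} (l : List V) : pe l.reverse = pe l := by
  induction l with
  | nil => rfl
  | cons x t ih =>
    cases t with
    | nil => rfl
    | cons y t =>
      rw [List.reverse_cons, List.reverse_cons, List.append_assoc, List.singleton_append, pe_append,
        ← List.reverse_cons, ih]
      simp only [pe]
      rw [Sym2.eq_swap, Multiset.cons_zero, add_comm, Multiset.singleton_add]

lemma pe_map {V W : Type*} (f : V → W) (l : List V) :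
    pe (l.map f) = (pe l).map (Sym2.map f) := by
  induction l with
  | nil => rfl
  | cons x t ih =>
    cases t with
    | nil => rfl
    | cons y t => simp only [List.map_cons, pe, Multiset.map_cons, Sym2.map_mk] at ih ⊢; rw [ih]

lemma ce_map {V W : Type*} (f : V → W) (l : List V) :
    ce (l.map f) = (ce l).map (Sym2.map f) := by
  cases l with
  | nil => rfl
  | cons x t => simp only [List.map_cons, ce, ← pe_map, List.map_append, List.map_nil]

lemma mem_of_mem_pe {V : Type*} {l : List V} {e : Sym2 V} (h : e ∈ pe l) {x : V} (hx : x ∈ e) :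
    x ∈ l := by
  induction l with
  | nil => simp [pe] at h
  | cons y t ih =>
    cases t with
    | nil => simp [pe] at h
    | cons z t =>
      simp only [pe, Multiset.mem_cons] at h
      rcases h with rfl | h
      · rcases Sym2.mem_iff.1 hx with rfl | rfl <;> simp
      · exact List.mem_cons_of_mem _ (ih h)

/-- Rotation to a chosen start. -/
lemma exists_rotate {V : Type*} {L : List V} {u : V} (hu : u ∈ L) :
    ∃ t, ce (u :: t) = ce L ∧ ((u :: t : List V) : Multiset V) = L := by
  obtain ⟨l₁, l₂, rfl⟩ := List.append_of_mem hu
  refine ⟨l₂ ++ l₁, ?_, ?_⟩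
  · cases l₁ with
    | nil => simp
    | cons x l =>
      have h1 : ce (u :: (l₂ ++ x :: l)) = pe ((u :: l₂) ++ x :: (l ++ [u])) := by simp [ce]
      have h2 : ce (x :: l ++ u :: l₂) = pe ((x :: l) ++ u :: (l₂ ++ [x])) := by simp [ce]
      rw [h1, h2, pe_append, pe_append (x :: l), add_comm]
      simp
  · rw [Multiset.coe_eq_coe, ← List.cons_append]
    exact List.perm_append_comm

/-- Edges of a petal. -/
def pt {V : Type*} (u : V) (P : List V) : Multiset (Sym2 V) := pe (u :: (P ++ [u]))

lemma pt_reverse {V : Type*} (u : V) (P : List V) : pt u P.reverse = pt u P := by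
  rw [pt, pt, ← pe_reverse]; simp

lemma pe_concat {V : Type*} (l : List V) (x y : V) :
    pe (l ++ [x, y]) = pe (l ++ [x]) + {s(x, y)} := by
  rw [pe_append]; simp [pe]

lemma pe_flat {V : Type*} (u : V) (Ps : List (List V)) :
    pe (Ps.flatMap (fun P => u :: P) ++ [u]) = (Ps.map (pt u)).sum := by
  induction Ps with
  | nil => simp [pe]
  | cons P Ps ih =>
    obtain ⟨X, hX⟩ : ∃ X, Ps.flatMap (fun P => u :: P) ++ [u] = u :: X := by
      cases Ps <;> simp
    rw [List.flatMap_cons, List.append_assoc, hX, pe_append, ← hX, ih]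
    simp [pt]

lemma ce_flat {V : Type*} (u : V) (P : List V) (Ps : List (List V)) :
    ce (u :: (P ++ Ps.flatMap (fun P => u :: P))) = pt u P + (Ps.map (pt u)).sum := by
  have := pe_flat u (P :: Ps)
  simpa [ce] using this

lemma coe_flat {V : Type*} (u : V) (Ps : List (List V)) :
    ((Ps.flatMap (fun P => u :: P) : List V) : Multiset V) =
      (Ps.map (fun P : List V => u ::ₘ (P : Multiset V))).sum := by
  induction Ps with
  | nil => simp
  | cons P Ps ih =>
    rw [List.flatMap_cons, ← Multiset.coe_add, ih]; simp

lemma exists_petals {V : Type*} [DecidableEq V] (u : V) (t : List V) :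
    ∃ P Ps, t = P ++ Ps.flatMap (fun P => u :: P) ∧ ∀ Q ∈ P :: Ps, u ∉ Q := by
  induction t with
  | nil => exact ⟨[], [], by simp⟩
  | cons x t ih =>
    obtain ⟨P, Ps, h1, h2⟩ := ih
    by_cases hx : x = u
    · refine ⟨[], P :: Ps, by simp [h1, hx], ?_⟩
      intro Q hQ
      rcases List.mem_cons.1 hQ with rfl | hQ
      · simp
      · exact h2 Q hQ
    · refine ⟨x :: P, Ps, by simp [h1], ?_⟩
      intro Q hQ
      rcases List.mem_cons.1 hQ with rfl | hQ
      · have := h2 P (by simp)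
        simp [this, Ne.symm hx]
      · exact h2 Q (by simp [hQ])

/-- One of the two ends of a petal. -/
def pend {V : Type*} (u : V) (P : List V) (b : Bool) : V :=
  if b then P.headD u else P.getLastD u

lemma dropLast_pend {V : Type*} (u : V) (P : List V) (hP : P ≠ []) :
    P.dropLast ++ [pend u P false] = P := by
  rcases List.eq_nil_or_concat P with rfl | ⟨l, x, rfl⟩
  · simp at hP
  · simp [pend]

lemma pend_spec {V : Type*} (u : V) (P : List V) (hP : P ≠ []) (b : Bool) :
    ∃ Q, pt u (Q ++ [pend u P b]) = pt u P ∧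
      ((Q ++ [pend u P b] : List V) : Multiset V) = P := by
  cases b with
  | false =>
    refine ⟨P.dropLast, ?_⟩
    have : P.dropLast ++ [pend u P false] = P := by
      exact dropLast_pend u P hP
    rw [this]; simp
  | true =>
    cases P with
    | nil => simp at hP
    | cons x t =>
      refine ⟨t.reverse, ?_⟩
      have : t.reverse ++ [pend u (x :: t) true] = (x :: t).reverse := by simp [pend]
      rw [this]
      exact ⟨pt_reverse _ _, Multiset.coe_reverse _⟩

lemma pt_eq {V : Type*} (u : V) (P : List V) (hP : P ≠ []) :
    pt u P = s(u, pend u P true) ::ₘ s(u, pend u P false) ::ₘ pe P := by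
  have h2 : P.dropLast ++ [pend u P false] = P := by
    exact dropLast_pend u P hP
  have h3 : pt u P = s(u, pend u P true) ::ₘ pe (P ++ [u]) := by
    cases P with
    | nil => simp at hP
    | cons x t => simp [pt, pe, pend]
  have h4 : pe (P ++ [u]) = pe P + {s(pend u P false, u)} := by
    conv_lhs => rw [← h2]
    conv_rhs => rw [← h2]
    simp only [List.append_assoc, List.singleton_append]
    rw [pe_concat]
    simp [h2]
  rw [h3, h4, Sym2.eq_swap (a := pend u P false), add_comm, Multiset.singleton_add]

lemma count_pt {V : Type*} [DecidableEq V] (u : V) (P : List V) (hP : P ≠ []) (hu : u ∉ P)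
    (x : V) :
    (pt u P).count s(u, x) = ∑ b : Bool, if pend u P b = x then 1 else 0 := by
  have h0 : (pe P).count s(u, x) = 0 := by
    rw [Multiset.count_eq_zero]
    intro h
    exact hu (mem_of_mem_pe h (by simp))
  rw [pt_eq u P hP, Multiset.count_cons, Multiset.count_cons, h0]
  have h : ∀ y, (s(u, x) = s(u, y)) ↔ (y = x) := fun y => by
    rw [Sym2.congr_right, eq_comm]
  simp only [h, Fintype.sum_bool]
  omega

lemma key {V : Type*} [DecidableEq V] (L : List V) (u : V) (k : ℕ) (hL : s(u, u) ∉ ce L)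
    (hk : L.count u = k) (hk2 : 2 ≤ k) :
    ∃ ends : Fin k → Bool → V,
      (∀ x, (ce L).count s(u, x) = ∑ j, ∑ b, if ends j b = x then 1 else 0) ∧
      ∀ v j₁ j₂ b₁ b₂, j₁ ≠ j₂ → ∃ L' : List V,
        ce L' + ({s(u, ends j₁ b₁)} + {s(u, ends j₂ b₂)}) =
          ce L + ({s(v, ends j₁ b₁)} + {s(v, ends j₂ b₂)}) ∧
        (L' : Multiset V) + {u} = L + {v} := by
  have huL : u ∈ L := List.count_pos_iff.1 (by omega)
  obtain ⟨t, ht1, ht2⟩ := exists_rotate huL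
  obtain ⟨P0, Ps0, hP1, hP2⟩ := exists_petals u t
  obtain ⟨Ps, rfl⟩ : ∃ Ps, Ps = P0 :: Ps0 := ⟨_, rfl⟩
  set Ps := P0 :: Ps0 with hPs
  have hce : ce L = (Ps.map (pt u)).sum := by
    rw [← ht1, hP1, ce_flat]; simp [hPs]
  have hco : (L : Multiset V) = (Ps.map (fun P : List V => u ::ₘ (P : Multiset V))).sum := by
    rw [← ht2, hP1, ← coe_flat]; simp [hPs]
  have hlen : Ps.length = k := by
    have h1 : ∀ Qs : List (List V), (∀ Q ∈ Qs, u ∉ Q) →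
        ((Qs.map (fun P : List V => u ::ₘ (P : Multiset V))).sum).count u = Qs.length := by
      intro Qs hQs
      induction Qs with
      | nil => simp
      | cons Q Qs ih =>
        have := ih (fun R hR => hQs R (by simp [hR]))
        have h3 := hQs Q (by simp)
        simp only [List.map_cons, List.sum_cons, Multiset.count_add, this, List.length_cons,
          Multiset.count_cons_self, Multiset.coe_count, List.count_eq_zero.2 h3]
        omega
    rw [← h1 Ps hP2, ← hco, Multiset.coe_count, hk]
  have hne : ∀ P ∈ Ps, P ≠ [] := by
    rintro P hP rfl
    apply hL
    rw [hce]
    have : pt u [] ≤ (Ps.map (pt u)).sum := 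
      List.single_le_sum (by simp) _ (List.mem_map_of_mem hP)
    exact Multiset.mem_of_le this (by simp [pt, pe])
  clear_value Ps
  subst hlen
  let P : Fin Ps.length → List V := Ps.get
  have hsum : ∀ {M : Type _} [AddCommMonoid M] (f : List V → M),
      (Ps.map f).sum = ∑ j, f (P j) := by
    intro M _ f
    rw [← List.sum_ofFn]
    congr 1
    conv_lhs => rw [← List.ofFn_get Ps, List.map_ofFn]
    rfl
  have hPne : ∀ j, P j ≠ [] := fun j => hne _ (List.get_mem _ _)
  have hPu : ∀ j, u ∉ P j := fun j => hP2 _ (List.get_mem _ _)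
  refine ⟨fun j b => pend u (P j) b, ?_, ?_⟩
  · intro x
    rw [hce, hsum, Multiset.count_sum']
    exact Finset.sum_congr rfl fun j _ => count_pt u (P j) (hPne j) (hPu j) x
  · intro v j₁ j₂ b₁ b₂ hj
    let R := ((Finset.univ.erase j₁).erase j₂).toList.map P
    have hR : ∀ {M : Type _} [AddCommMonoid M] (f : List V → M),
        (Ps.map f).sum = f (P j₁) + (f (P j₂) + (R.map f).sum) := by
      intro M _ f
      rw [hsum, ← Finset.add_sum_erase _ _ (Finset.mem_univ j₁),
        ← Finset.add_sum_erase (Finset.univ.erase j₁) _ (a := j₂) (by simp [hj.symm])]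
      simp only [R, List.map_map]
      rw [← Finset.sum_map_toList]
      rfl
    obtain ⟨Q₁, h11, h12⟩ := pend_spec u (P j₁) (hPne j₁) b₁
    obtain ⟨Q₂, h21, h22⟩ := pend_spec u (P j₂) (hPne j₂) b₂
    dsimp only
    generalize pend u (P j₁) b₁ = e₁ at *
    generalize pend u (P j₂) b₂ = e₂ at *
    refine ⟨u :: (Q₁ ++ e₁ :: v :: e₂ :: (Q₂.reverse ++ R.flatMap (fun P => u :: P))), ?_, ?_⟩
    · have hA : ce (u :: (Q₁ ++ e₁ :: v :: e₂ :: (Q₂.reverse ++ R.flatMap (fun P => u :: P)))) =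
          pe (u :: (Q₁ ++ [e₁])) + {s(v, e₁)} + {s(v, e₂)} + pe (e₂ :: (Q₂.reverse ++ [u]))
            + (R.map (pt u)).sum := by
        obtain ⟨X, hX⟩ : ∃ X, R.flatMap (fun P => u :: P) ++ [u] = u :: X := by
          cases R <;> simp
        have e1 : ce (u :: (Q₁ ++ e₁ :: v :: e₂ :: (Q₂.reverse ++ R.flatMap (fun P => u :: P)))) =
          pe ((u :: Q₁) ++ e₁ :: v :: (e₂ :: Q₂.reverse ++ (R.flatMap (fun P => u :: P) ++ [u]))) := by
          simp [ce]
        rw [e1, pe_append, hX]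
        simp only [pe, List.cons_append]
        have hY := pe_append (e₂ :: Q₂.reverse) u X
        simp only [List.cons_append] at hY
        rw [hY, ← hX, pe_flat, Sym2.eq_swap (a := e₁)]
        simp only [← Multiset.singleton_add, List.cons_append]
        abel
      have hB : pt u (P j₁) = pe (u :: (Q₁ ++ [e₁])) + {s(u, e₁)} := by
        rw [← h11, pt, Sym2.eq_swap]
        have := pe_concat (u :: Q₁) e₁ u
        simpa using this
      have hC : pt u (P j₂) = pe (e₂ :: (Q₂.reverse ++ [u])) + {s(u, e₂)} := by
        rw [← h21, ← pt_reverse, pt]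
        simp [pe, ← Multiset.singleton_add, add_comm]
      rw [hA, hce, hR, hB, hC]
      abel
    · rw [hco, hR, ← h12, ← h22, ← coe_flat]
      simp only [← Multiset.singleton_add, ← Multiset.coe_add, ← Multiset.cons_coe, Multiset.coe_reverse,
        Multiset.coe_nil, add_zero]
      abel

end HPD
namespace HPD

lemma exists_split {E R : Type*} [Fintype E] [DecidableEq R] (k : ℕ)
    (r : E → R) (w : R → ℕ) (h : ∀ y, (Finset.univ.filter (fun e => r e = y)).card = k * w y) :
    ∃ r' : E → (Σ y, Fin (w y)), (∀ e, (r' e).1 = r e) ∧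
      ∀ z, (Finset.univ.filter (fun e => r' e = z)).card = k := by
  classical
  have hc : ∀ y, Nonempty ({e // r e = y} ≃ Fin (w y) × Fin k) := by
    intro y
    apply Fintype.card_eq.1
    rw [Fintype.card_subtype, h]; simp [mul_comm]
  let φ := fun y => (hc y).some
  refine ⟨fun e => ⟨r e, (φ (r e) ⟨e, rfl⟩).1⟩, fun e => rfl, ?_⟩
  rintro ⟨y, i⟩
  have hinj : Function.Injective (fun t : Fin k => ((φ y).symm (i, t)).1) := by
    intro t t' htt
    have := (φ y).symm.injective (Subtype.ext htt)
    simpa using this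
  have : (Finset.univ.filter (fun e => (⟨r e, (φ (r e) ⟨e, rfl⟩).1⟩ : Σ y, Fin (w y)) = ⟨y, i⟩)) =
      Finset.univ.image (fun t : Fin k => ((φ y).symm (i, t)).1) := by
    ext e
    simp only [Finset.mem_filter, Finset.mem_univ, true_and, Finset.mem_image]
    constructor
    · intro he
      obtain ⟨rfl, h2⟩ := Sigma.mk.inj_iff.1 he
      have h2 := eq_of_heq h2
      refine ⟨(φ (r e) ⟨e, rfl⟩).2, ?_⟩
      rw [← h2]; simp
    · rintro ⟨t, rfl⟩
      have h1 := ((φ y).symm (i, t)).2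
      have h3 : ∀ (y') (x : {e // r e = y}) (hy : r x.1 = y'), 
          (⟨y', (φ y' ⟨x.1, hy⟩).1⟩ : Σ y, Fin (w y)) = ⟨y, (φ y x).1⟩ := by
        rintro y' ⟨x, rfl⟩ hy
        subst hy; rfl
      rw [h3 _ ((φ y).symm (i, t)) rfl]
      simp
  rw [this, Finset.card_image_of_injective _ hinj]; simp

lemma exists_choice {L T R : Type*} [Fintype L] [Fintype T] [Fintype R] [DecidableEq R]
    [Nonempty T] (r : L → T → R) (w : R → ℕ)
    (h : ∀ y, (Finset.univ.filter (fun e : L × T => r e.1 e.2 = y)).card = Fintype.card T * w y) :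
    ∃ c : L → T, ∀ y, (Finset.univ.filter (fun x => r x (c x) = y)).card = w y := by
  classical
  obtain ⟨r', h1, h2⟩ := exists_split (Fintype.card T) (fun e : L × T => r e.1 e.2) w h
  set k := Fintype.card T with hk
  have hkpos : 0 < k := Fintype.card_pos
  have hall : ∀ S : Finset L, S.card ≤
      (S.biUnion (fun x => Finset.univ.image (fun t => r' (x, t)))).card := by
    intro S
    have e1 : ((S ×ˢ (Finset.univ : Finset T))).card ≤
        (S.biUnion (fun x => Finset.univ.image (fun t => r' (x, t)))).card * k := by
      rw [mul_comm]
      refine Finset.card_le_mul_card_image_of_maps_to (f := r') ?_ k ?_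
      · rintro ⟨x, t⟩ hx
        simp only [Finset.mem_biUnion, Finset.mem_image, Finset.mem_univ, true_and]
        exact ⟨x, (Finset.mem_product.1 hx).1, t, rfl⟩
      · intro z _
        rw [← h2 z]
        exact Finset.card_le_card (Finset.filter_subset_filter _ (Finset.subset_univ _))
    rw [Finset.card_product, Finset.card_univ, ← hk] at e1
    exact Nat.le_of_mul_le_mul_right e1 hkpos
  obtain ⟨f, hf, hf2⟩ := (Finset.all_card_le_biUnion_card_iff_exists_injective _).1 hall
  have hcard : Fintype.card L = Fintype.card (Σ y, Fin (w y)) := by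
    have : Fintype.card (L × T) = ∑ _z : (Σ y, Fin (w y)), k := by
      rw [← Finset.card_univ, Finset.card_eq_sum_card_fiberwise (f := r') (t := Finset.univ)
        (by simp)]
      exact Finset.sum_congr rfl fun z _ => h2 z
    rw [Fintype.card_prod, Finset.sum_const, Finset.card_univ, smul_eq_mul] at this
    exact Nat.eq_of_mul_eq_mul_right hkpos this
  have hbij : Function.Bijective f := (Fintype.bijective_iff_injective_and_card f).2 ⟨hf, hcard⟩
  have hf3 : ∀ x, ∃ t, r' (x, t) = f x := by
    intro x; simpa using hf2 x
  choose c hc using hf3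
  refine ⟨c, fun y => ?_⟩
  have : ∀ x, r x (c x) = (f x).1 := fun x => by rw [← hc x, h1]
  simp only [this]
  have e2 : (Finset.univ.filter (fun x => (f x).1 = y)).card =
      (Finset.univ.filter (fun z : Σ y, Fin (w y) => z.1 = y)).card := by
    refine Finset.card_bijective f hbij ?_
    intro x; simp
  rw [e2]
  have e3 : (Finset.univ.filter (fun z : Σ y, Fin (w y) => z.1 = y)) =
      Finset.univ.map (Function.Embedding.sigmaMk (β := fun y => Fin (w y)) y) := by
    ext ⟨y', i⟩
    simp only [Finset.mem_filter, Finset.mem_univ, true_and, Finset.mem_map]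
    constructor
    · rintro rfl; exact ⟨i, rfl⟩
    · rintro ⟨j, hj⟩; exact (congrArg Sigma.fst hj).symm
  rw [e3]; simp

end HPD
namespace HPD

/-- Invariant of the detachment process. -/
structure Inv {V G C : Type*} [Fintype V] [DecidableEq V] [DecidableEq G] [Fintype C]
    (g : V → G) (e₀ : Sym2 G) (w : V → ℕ) (L : C → List V) : Prop where
  cnt : ∀ p x, (L p).count x = w x
  edg : ∀ x y, ∑ p, (ce (L p)).count s(x, y) = if g x = g y then 0 else w x * w y
  fair : ∀ p, ((ce (L p)).map (Sym2.map g)).count e₀ = 1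
  tot : ∀ v, ∑ x with g x = g v, w x = (Finset.univ.filter (fun x => g x = g v)).card

lemma two_of_count {k : ℕ} (hk : 2 ≤ k) {T : Type*} (c : Fin k → Bool ⊕ T)
    (h : ∑ j, (if (c j).isRight then 1 else 0) = k - 2) :
    ∃ j₁ j₂ b₁ b₂, j₁ ≠ j₂ ∧ c j₁ = .inl b₁ ∧ c j₂ = .inl b₂ ∧
      ∀ j, j ≠ j₁ → j ≠ j₂ → ∃ t, c j = .inr t := by
  classical
  have h2 : (Finset.univ.filter (fun j => ¬ (c j).isRight = true)).card = 2 := by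
    have := Finset.card_filter_add_card_filter_not (s := (Finset.univ : Finset (Fin k)))
      (fun j => (c j).isRight = true)
    rw [Finset.card_filter, h, Finset.card_univ, Fintype.card_fin] at this
    omega
  obtain ⟨j₁, j₂, hne, hS⟩ := Finset.card_eq_two.1 h2
  have hm : ∀ j, (¬ (c j).isRight = true) ↔ (j = j₁ ∨ j = j₂) := by
    intro j
    have : j ∈ (Finset.univ.filter (fun j => ¬ (c j).isRight = true)) ↔ j ∈ ({j₁, j₂} : Finset _) := by
      rw [hS]
    simpa using this
  have hl : ∀ j, (j = j₁ ∨ j = j₂) → ∃ b, c j = .inl b := by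
    intro j hj
    have := (hm j).2 hj
    cases hc : c j with
    | inl b => exact ⟨b, rfl⟩
    | inr t => simp [hc] at this
  obtain ⟨b₁, hb₁⟩ := hl j₁ (Or.inl rfl)
  obtain ⟨b₂, hb₂⟩ := hl j₂ (Or.inr rfl)
  refine ⟨j₁, j₂, b₁, b₂, hne, hb₁, hb₂, fun j h1 h2 => ?_⟩
  have := mt (hm j).1 (by tauto)
  cases hc : c j with
  | inl b => simp [hc] at this
  | inr t => exact ⟨t, rfl⟩

lemma arith {V G : Type*} [DecidableEq V] [DecidableEq G] (g : V → G) (w : V → ℕ) (u v : V)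
    (huv : g u = g v) (hv : w v = 0) (hu : 2 ≤ w u) (hne : u ≠ v) (x y : V) (N : ℕ)
    (h : N + (if x = u then (if g y = g u then 0 else w y) else
          if y = u then (if g x = g u then 0 else w x) else 0) =
        (if g x = g y then 0 else w x * w y) +
          (if x = v then (if g y = g u then 0 else w y) else
            if y = v then (if g x = g u then 0 else w x) else 0)) :
    N = if g x = g y then 0 else
      Function.update (Function.update w u (w u - 1)) v 1 x *
        Function.update (Function.update w u (w u - 1)) v 1 y := by
  obtain ⟨m, hm⟩ : ∃ m, w u = m + 1 := ⟨w u - 1, by omega⟩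
  have hvu : v ≠ u := hne.symm
  have hU : Function.update (Function.update w u (w u - 1)) v 1 u = m := by
    simp [Function.update_apply, hne, hm]
  have hV : Function.update (Function.update w u (w u - 1)) v 1 v = 1 := by simp
  have hO : ∀ z, z ≠ u → z ≠ v →
      Function.update (Function.update w u (w u - 1)) v 1 z = w z := by
    intro z h1 h2; simp [Function.update_apply, h1, h2]
  generalize Function.update (Function.update w u (w u - 1)) v 1 = w' at *
  by_cases hxu : x = u
  · subst hxu
    by_cases hyu : y = x
    · subst hyu; simpa [hne] using h
    · by_cases hyv : y = v
      · subst hyv; simpa [huv, hne] using h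
      · by_cases hg : g x = g y
        · simpa [hg, hne, hyv] using h
        · rw [hO y hyu hyv, hU]
          simp [hg, hne, hyv, hm, Ne.symm hg] at h ⊢
          linarith
  · by_cases hxv : x = v
    · subst hxv
      by_cases hyu : y = u
      · subst hyu; simpa [huv, hxu] using h
      · by_cases hyv : y = x
        · subst hyv; simpa [huv, hxu] using h
        · by_cases hg : g x = g y
          · simpa [hg, huv, hxu, hyu] using h
          · rw [hO y hyu hyv, hV]
            simp [hg, hxu, hyu, hv, huv, Ne.symm hg] at h ⊢
            exact h
    · rw [hO x hxu hxv]
      by_cases hyu : y = u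
      · subst hyu
        by_cases hg : g x = g y
        · simpa [hg, hxu, hxv, hne] using h
        · rw [hU]
          simp [hg, hxu, hxv, hm, hne] at h ⊢
          linarith
      · by_cases hyv : y = v
        · subst hyv
          by_cases hg : g x = g y
          · simpa [hg, hxu, hxv, hyu, huv] using h
          · rw [hV]
            simp [hg, hxu, hxv, hyu, hv, huv] at h ⊢
            exact h
        · rw [hO y hyu hyv]
          simpa [hxu, hxv, hyu, hyv] using h

lemma step {V G C : Type*} [Fintype V] [DecidableEq V] [DecidableEq G] [Fintype C]
    (g : V → G) (e₀ : Sym2 G) (w : V → ℕ) (L : C → List V) (hI : Inv g e₀ w L)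
    (u v : V) (huv : g u = g v) (hv : w v = 0) (hu : 2 ≤ w u) :
    ∃ L' : C → List V, Inv g e₀ (Function.update (Function.update w u (w u - 1)) v 1) L' := by
  classical
  have hne : u ≠ v := by rintro rfl; omega
  obtain ⟨k, hk⟩ : ∃ k, k = w u := ⟨_, rfl⟩
  have hk2 : 2 ≤ k := by omega
  have hloop : ∀ p, s(u, u) ∉ ce (L p) := by
    intro p
    have := hI.edg u u
    rw [if_pos rfl, Finset.sum_eq_zero_iff] at this
    exact Multiset.count_eq_zero.1 (this p (Finset.mem_univ _))
  choose ends hcount hmod using fun p => key (L p) u k (hloop p) (by rw [hI.cnt, hk]) hk2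
  let r : C × Fin k → Bool ⊕ Fin (k - 2) → V ⊕ C := fun pj t =>
    match t with
    | .inl b => .inl (ends pj.1 pj.2 b)
    | .inr _ => .inr pj.1
  let wx : V → ℕ := fun x => if g x = g u then 0 else w x
  let wt : V ⊕ C → ℕ := Sum.elim wx (fun _ => k - 2)
  obtain ⟨c, hc⟩ := exists_choice r wt (by
    intro y
    rw [Finset.card_filter, Fintype.sum_prod_type, Fintype.sum_prod_type]
    simp only [Fintype.sum_sum_type]
    have hT : Fintype.card (Bool ⊕ Fin (k - 2)) = k := by simp; omega
    rw [hT]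
    cases y with
    | inl x =>
      have h1 := hI.edg u x
      simp only [hcount] at h1
      simp only [r, Sum.inl.injEq, reduceCtorEq, if_false, Finset.sum_const_zero, add_zero, wt,
        Sum.elim_inl, wx]
      rw [h1, hk]
      by_cases hg : g u = g x
      · simp [hg]
      · simp [hg, Ne.symm hg]
    | inr p =>
      simp [r, wt])
  have hper : ∀ p, ∃ (L' : List V) (e₁ e₂ : V),
      (ce L' + ({s(u, e₁)} + {s(u, e₂)}) = ce (L p) + ({s(v, e₁)} + {s(v, e₂)})) ∧
      ((L' : Multiset V) + {u} = L p + {v}) ∧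
      ∀ x, (∑ j, if r (p, j) (c (p, j)) = .inl x then 1 else 0) =
        (if e₁ = x then 1 else 0) + (if e₂ = x then 1 else 0) := by
    intro p
    have h1 : ∑ j, (if (c (p, j)).isRight then 1 else 0) = k - 2 := by
      have h2 := hc (.inr p)
      rw [Finset.card_filter, Fintype.sum_prod_type] at h2
      have h3 : ∀ p' j, (r (p', j) (c (p', j)) = .inr p) ↔ (p' = p ∧ (c (p', j)).isRight) := by
        intro p' j
        cases c (p', j) <;> simp [r]
      simp only [h3] at h2
      rw [Finset.sum_eq_single p] at h2
      · simpa [wt] using h2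
      · intro q _ hq; simp [hq]
      · simp
    obtain ⟨j₁, j₂, b₁, b₂, hj, hc1, hc2, hc3⟩ := two_of_count hk2 (fun j => c (p, j)) h1
    obtain ⟨L', hL1, hL2⟩ := hmod p v j₁ j₂ b₁ b₂ hj
    refine ⟨L', ends p j₁ b₁, ends p j₂ b₂, hL1, hL2, fun x => ?_⟩
    rw [Finset.sum_eq_add j₁ j₂ hj]
    · simp [hc1, hc2, r]
    · rintro j - ⟨ha, hb⟩
      obtain ⟨t, ht⟩ := hc3 j ha hb
      simp [ht, r]
    · simp
    · simp
  choose L' e₁ e₂ hE hM hx using hper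
  have hwx : ∀ x, ∑ p, ((if e₁ p = x then 1 else 0) + (if e₂ p = x then 1 else 0)) = wx x := by
    intro x
    have := hc (.inl x)
    rw [Finset.card_filter, Fintype.sum_prod_type] at this
    simp only [hx] at this
    exact this
  have hwxg : ∀ x, g x = g u → wx x = 0 := fun x h => by simp [wx, h]
  have hD : ∀ z, g z = g u → ∀ x y, ∑ p, (({s(z, e₁ p)} : Multiset (Sym2 V)).count s(x, y) +
      ({s(z, e₂ p)} : Multiset (Sym2 V)).count s(x, y)) =
      if x = z then wx y else if y = z then wx x else 0 := by
    intro z hz x y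
    simp only [Multiset.count_singleton]
    split_ifs with h1 h2
    · subst h1
      rw [← hwx y]
      simp only [Sym2.congr_right, eq_comm]
    · subst h2
      rw [← hwx x]
      simp only [Sym2.eq_swap (a := x), Sym2.congr_right, eq_comm]
    · refine Finset.sum_eq_zero fun p _ => ?_
      have : ∀ e, s(x, y) ≠ s(z, e) := by
        intro e he
        rcases Sym2.eq_iff.1 he with ⟨h, -⟩ | ⟨-, h⟩
        · exact h1 h
        · exact h2 h
      simp [this]
  refine ⟨L', ⟨?_, ?_, ?_, ?_⟩⟩
  · intro p x
    have h1 := congrArg (Multiset.count x) (hM p)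
    simp only [Multiset.count_add, Multiset.coe_count, hI.cnt, Multiset.count_singleton] at h1
    by_cases hxv : x = v
    · subst hxv
      simp [Ne.symm hne, hv] at h1 ⊢
      exact h1
    · by_cases hxu : x = u
      · subst hxu
        simp [hne] at h1 ⊢
        omega
      · simp [hxu, hxv] at h1 ⊢
        exact h1
  · intro x y
    have h1 : ∑ p, (ce (L' p)).count s(x, y) + (if x = u then wx y else if y = u then wx x else 0)
        = (if g x = g y then 0 else w x * w y) +
          (if x = v then wx y else if y = v then wx x else 0) := by
      rw [← hD u rfl, ← hD v huv.symm, ← hI.edg, ← Finset.sum_add_distrib, ← Finset.sum_add_distrib]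
      refine Finset.sum_congr rfl fun p _ => ?_
      have := congrArg (Multiset.count s(x, y)) (hE p)
      simpa only [Multiset.count_add] using this
    exact arith g w u v huv hv hu hne x y _ h1
  · intro p
    rw [← hI.fair p]
    have := congrArg (Multiset.map (Sym2.map g)) (hE p)
    simp only [Multiset.map_add, Multiset.map_singleton, Sym2.map_mk, huv] at this
    rw [add_right_cancel this]
  · intro z
    rw [← hI.tot z]
    by_cases hz : g u = g z
    · have hmu : u ∈ Finset.univ.filter (fun x => g x = g z) := by simp [hz]
      have hmv : v ∈ (Finset.univ.filter (fun x => g x = g z)).erase u := by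
        simp [← huv, hz, hne.symm]
      rw [← Finset.add_sum_erase _ _ hmu, ← Finset.add_sum_erase _ _ hmv,
        ← Finset.add_sum_erase _ w hmu, ← Finset.add_sum_erase _ w hmv]
      have : ∑ x ∈ ((Finset.univ.filter (fun x => g x = g z)).erase u).erase v,
          Function.update (Function.update w u (w u - 1)) v 1 x =
          ∑ x ∈ ((Finset.univ.filter (fun x => g x = g z)).erase u).erase v, w x := by
        refine Finset.sum_congr rfl fun x hx => ?_
        simp only [Finset.mem_erase] at hx
        simp [Function.update_apply, hx.1, hx.2.1]
      rw [this]
      simp [Function.update_apply, hne, hv]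
      omega
    · refine Finset.sum_congr rfl fun x hx => ?_
      have hx : g x = g z := by simpa using hx
      have h1 : x ≠ v := by rintro rfl; exact hz (huv.trans hx)
      have h2 : x ≠ u := by rintro rfl; exact hz hx
      simp [Function.update_apply, h1, h2]

lemma detach {V G C : Type*} [Fintype V] [DecidableEq V] [DecidableEq G] [Fintype C]
    (g : V → G) (e₀ : Sym2 G) (n : ℕ) : ∀ (w : V → ℕ) (L : C → List V), Inv g e₀ w L →
    (Finset.univ.filter (fun x => w x = 0)).card = n →
    ∃ L' : C → List V, Inv g e₀ (fun _ => 1) L' := by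
  induction n with
  | zero =>
    intro w L hI hn
    have hw : ∀ x, 1 ≤ w x := by
      intro x
      have := Finset.card_eq_zero.1 hn
      have := Finset.filter_eq_empty_iff.1 this (Finset.mem_univ x)
      omega
    have : w = fun _ => 1 := by
      funext v
      have h1 := hI.tot v
      rw [Finset.card_eq_sum_ones] at h1
      have := (Finset.sum_eq_sum_iff_of_le (fun x _ => hw x)).1 h1.symm v (by simp)
      exact this.symm
    exact ⟨L, this ▸ hI⟩
  | succ n ih =>
    intro w L hI hn
    obtain ⟨v, hv⟩ := Finset.card_pos.1 (by rw [hn]; omega)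
    have hv : w v = 0 := by simpa using hv
    obtain ⟨u, hu, hu2⟩ : ∃ u, g u = g v ∧ 2 ≤ w u := by
      by_contra! hcon
      have h1 := hI.tot v
      rw [Finset.card_eq_sum_ones] at h1
      have := (Finset.sum_eq_sum_iff_of_le (fun x hx => by
        have := hcon x (by simpa using hx)
        show w x ≤ 1
        omega)).1 h1 v (by simp)
      omega
    obtain ⟨L', hL'⟩ := step g e₀ w L hI u v hu hv hu2
    refine ih _ L' hL' ?_
    have : (Finset.univ.filter (fun x =>
        Function.update (Function.update w u (w u - 1)) v 1 x = 0)) =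
        (Finset.univ.filter (fun x => w x = 0)).erase v := by
      ext x
      simp only [Function.update_apply, Finset.mem_filter, Finset.mem_univ, true_and,
        Finset.mem_erase]
      by_cases hxv : x = v
      · simp [hxv]
      · by_cases hxu : x = u
        · subst hxu; simp [hxv]; omega
        · simp [hxv, hxu]
    rw [this, Finset.card_erase_of_mem (by simp [hv]), hn]
    rfl

end HPD
namespace HPD

lemma pe_range {V : Type*} (f : ℕ → V) (m : ℕ) :
    pe ((List.range (m + 1)).map f) = ∑ t ∈ Finset.range m, {s(f t, f (t + 1))} := by
  induction m with
  | zero => simp [pe]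
  | succ m ih =>
    rw [Finset.sum_range_succ, ← ih, List.range_succ, List.range_succ]
    simp only [List.map_append, List.map_cons, List.map_nil, List.append_assoc, List.singleton_append]
    exact pe_concat _ _ _

lemma ce_range {V : Type*} (f : ℕ → V) (m : ℕ) (hf : f m = f 0) (hm : 0 < m) :
    ce ((List.range m).map f) = ∑ t ∈ Finset.range m, {s(f t, f (t + 1))} := by
  rw [← pe_range, List.range_succ]
  obtain ⟨k, rfl⟩ : ∃ k, m = k + 1 := ⟨m - 1, by omega⟩
  rw [List.range_succ_eq_map]
  simp [ce, hf]

lemma sum_range_mul' {M : Type*} [AddCommMonoid M] (n a : ℕ) (h : ℕ → M) :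
    ∑ t ∈ Finset.range (n * a), h t =
      ∑ q ∈ Finset.range n, ∑ r ∈ Finset.range a, h (q * a + r) := by
  induction n with
  | zero => simp
  | succ n ih => rw [Nat.succ_mul, Finset.sum_range_add, ih, Finset.sum_range_succ]

/-- The vertices of an Euler circuit in the complete graph on `ZMod n`, with steps
`1, 2, ..., a, 1, 2, ..., a, ...`. -/
def eul (a n : ℕ) (t : ℕ) : ZMod n := ∑ i ∈ Finset.range t, ((i % a + 1 : ℕ) : ZMod n)

lemma eul_succ (a n t : ℕ) : eul a n (t + 1) = eul a n t + ((t % a + 1 : ℕ) : ZMod n) := by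
  rw [eul, Finset.sum_range_succ]; rfl

lemma eul_add (a n q r : ℕ) : eul a n (q * a + r) = q * eul a n a + eul a n r := by
  have h1 : ∀ r, eul a n (a + r) = eul a n a + eul a n r := by
    intro r
    rw [eul, Finset.sum_range_add]
    simp [eul]
  induction q with
  | zero => simp
  | succ q ih =>
    rw [show (q + 1) * a + r = a + (q * a + r) by ring, h1, ih]
    push_cast; ring

lemma eul_unit (a : ℕ) : eul a (2 * a + 1) a * (-8) = 1 := by
  have h1 : ∀ r ≤ a, eul a (2 * a + 1) r * 2 = (r : ZMod (2 * a + 1)) * (r + 1) := by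
    intro r hr
    induction r with
    | zero => simp [eul]
    | succ r ih =>
      rw [eul_succ, add_mul, ih (by omega), Nat.mod_eq_of_lt (by omega)]
      push_cast; ring
  have h2 := h1 a le_rfl
  have h3 : ((2 * a + 1 : ℕ) : ZMod (2 * a + 1)) = 0 := ZMod.natCast_self _
  push_cast at h3
  have : eul a (2 * a + 1) a * (-8) = 1 - (2 * (a : ZMod (2 * a + 1)) + 1) ^ 2 := by
    linear_combination (-4) * h2
  rw [this, h3]; ring

lemma sum_cast {M : Type*} [AddCommMonoid M] (n : ℕ) [NeZero n] (F : ZMod n → M) :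
    ∑ q ∈ Finset.range n, F (q : ZMod n) = ∑ z, F z := by
  refine Finset.sum_nbij' (fun q => (q : ZMod n)) ZMod.val ?_ ?_ ?_ ?_ ?_
  · simp
  · intro z _; simpa using ZMod.val_lt z
  · intro q hq; exact ZMod.val_cast_of_lt (by simpa using hq)
  · intro z _; simp
  · simp

lemma eul_sum {M : Type*} [AddCommMonoid M] (a : ℕ) (h : ZMod (2 * a + 1) → ℕ → M) :
    ∑ t ∈ Finset.range ((2 * a + 1) * a), h (eul a (2 * a + 1) t) (t % a) =
      ∑ r ∈ Finset.range a, ∑ z, h z r := by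
  rw [sum_range_mul', Finset.sum_comm]
  refine Finset.sum_congr rfl fun r hr => ?_
  have hr : r < a := by simpa using hr
  have : ∀ q, (q * a + r) % a = r := by
    intro q; rw [Nat.mul_add_mod_self_right, Nat.mod_eq_of_lt hr]
  simp only [eul_add, this]
  rw [sum_cast (2 * a + 1)
    (fun q => h (q * eul a (2 * a + 1) a + eul a (2 * a + 1) r) r)]
  have hu := eul_unit a
  refine Fintype.sum_equiv
    ⟨fun z => z * eul a (2 * a + 1) a + eul a (2 * a + 1) r,
      fun z => (z - eul a (2 * a + 1) r) * (-8), ?_, ?_⟩ _ _ ?_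
  · intro z; simp only; linear_combination z * hu
  · intro z; simp only; linear_combination (z - eul a (2 * a + 1) r) * hu
  · intro z; rfl

lemma exists_euler (a : ℕ) (ha : 1 ≤ a) : ∃ L : List (ZMod (2 * a + 1)),
    (∀ i, L.count i = a) ∧ ∀ i j, (ce L).count s(i, j) = if i = j then 0 else 1 := by
  refine ⟨(List.range ((2 * a + 1) * a)).map (eul a (2 * a + 1)), ?_, ?_⟩
  · intro i
    have h1 : ∀ m, ((List.range m).map (eul a (2 * a + 1))).count i =
        ∑ t ∈ Finset.range m, if eul a (2 * a + 1) t = i then 1 else 0 := by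
      intro m
      induction m with
      | zero => simp
      | succ m ih => 
        rw [List.range_succ, Finset.sum_range_succ, List.map_append, List.count_append, ih]
        simp [List.count_singleton]
    rw [h1, eul_sum a (fun z _ => if z = i then 1 else 0)]
    simp
  · intro i j
    rw [ce_range _ _ _ (by positivity), Multiset.count_sum']
    swap
    · have := eul_add a (2 * a + 1) (2 * a + 1) 0
      rw [add_zero, ZMod.natCast_self, zero_mul, zero_add] at this
      exact this
    simp only [eul_succ, Multiset.count_singleton]
    rw [eul_sum a (fun z r => if s(i, j) = s(z, z + ((r + 1 : ℕ) : ZMod (2 * a + 1))) then 1 else 0)]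
    have hval : ∀ (δ : ZMod (2 * a + 1)) (r : ℕ), r ∈ Finset.range a →
        ((δ = ((r + 1 : ℕ) : ZMod (2 * a + 1))) ↔ r + 1 = δ.val) := by
      intro δ r hr
      have hr : r < a := by simpa using hr
      constructor
      · rintro rfl; rw [ZMod.val_cast_of_lt (by omega)]
      · intro h; rw [h]; simp
    by_cases hij : i = j
    · subst hij
      rw [if_pos rfl]
      refine Finset.sum_eq_zero fun r hr => Finset.sum_eq_zero fun z _ => ?_
      rw [if_neg]
      intro h
      have h0 : (0 : ZMod (2 * a + 1)) = ((r + 1 : ℕ) : ZMod (2 * a + 1)) := by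
        rcases Sym2.eq_iff.1 h with ⟨h1, h2⟩ | ⟨h1, h2⟩
        · rw [h1] at h2; simpa [eq_comm] using h2
        · rw [h2] at h1; simpa [eq_comm] using h1
      have := (hval 0 r hr).1 h0
      simp at this
    · rw [if_neg hij]
      have h1 : ∀ r ∈ Finset.range a, (∑ z, if s(i, j) = s(z, z + ((r + 1 : ℕ) : ZMod (2 * a + 1)))
          then 1 else 0) = (if r + 1 = (j - i).val then 1 else 0) +
            (if r + 1 = (i - j).val then 1 else 0) := by
        intro r hr
        rw [Finset.sum_eq_add i j hij]
        · congr 1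
          · refine if_congr ?_ rfl rfl
            rw [Sym2.congr_right, ← hval _ r hr, sub_eq_iff_eq_add, add_comm i]
          · refine if_congr ?_ rfl rfl
            rw [Sym2.eq_swap, Sym2.congr_right, ← hval _ r hr, sub_eq_iff_eq_add, add_comm j]
        · rintro z - ⟨hz1, hz2⟩
          rw [if_neg]
          intro h
          rcases Sym2.eq_iff.1 h with ⟨h, -⟩ | ⟨-, h⟩
          · exact hz1 h.symm
          · exact hz2 h.symm
        · simp
        · simp
      rw [Finset.sum_congr rfl h1, Finset.sum_add_distrib]
      have h2 : ∀ m, 1 ≤ m → (∑ r ∈ Finset.range a, if r + 1 = m then 1 else 0) =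
          if m ≤ a then 1 else 0 := by
        intro m hm
        obtain ⟨k, rfl⟩ : ∃ k, m = k + 1 := ⟨m - 1, by omega⟩
        simp [Nat.succ_le_iff]
      have hne : j - i ≠ 0 := sub_ne_zero.2 (Ne.symm hij)
      have hpos : 1 ≤ (j - i).val := by
        rw [Nat.one_le_iff_ne_zero, Ne, ZMod.val_eq_zero]; exact hne
      have hneg : (i - j).val = 2 * a + 1 - (j - i).val := by
        have : NeZero (j - i) := ⟨hne⟩
        rw [← neg_sub j i, ZMod.val_neg_of_ne_zero]
      have hlt := ZMod.val_lt (j - i)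
      rw [h2 _ hpos, h2 _ (by omega), hneg]
      split_ifs <;> omega

lemma exists_init {V : Type*} [Fintype V] [DecidableEq V] (a : ℕ) (ha : 1 ≤ a)
    (g : V → ZMod (2 * a + 1))
    (hg : ∀ i, (Finset.univ.filter (fun x => g x = i)).card = a) :
    ∃ (w : V → ℕ) (L : Fin (a ^ 2) → List V), Inv g s(0, 1) w L := by
  obtain ⟨L₀, h1, h2⟩ := exists_euler a ha
  have hs : ∀ i, ∃ x, g x = i := by
    intro i
    obtain ⟨x, hx⟩ := Finset.card_pos.1 (by rw [hg i]; omega)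
    exact ⟨x, by simpa using hx⟩
  choose ρ hρ using hs
  have hinj : Function.Injective ρ := Function.LeftInverse.injective hρ
  refine ⟨fun x => if ρ (g x) = x then a else 0, fun _ => L₀.map ρ, ⟨?_, ?_, ?_, ?_⟩⟩
  · intro p x
    split_ifs with h
    · conv_lhs => rw [← h]
      rw [List.count_map_of_injective _ _ hinj, h1]
    · rw [List.count_eq_zero]
      intro hx
      obtain ⟨i, -, rfl⟩ := List.mem_map.1 hx
      exact h (by rw [hρ])
  · intro x y
    simp only [ce_map, Finset.sum_const, Finset.card_univ, Fintype.card_fin, smul_eq_mul]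
    have hz : ∀ x y, ρ (g x) ≠ x → ((ce L₀).map (Sym2.map ρ)).count s(x, y) = 0 := by
      intro x y hx
      rw [Multiset.count_eq_zero]
      intro h
      obtain ⟨e, -, he⟩ := Multiset.mem_map.1 h
      have : x ∈ Sym2.map ρ e := by rw [he]; simp
      obtain ⟨i, -, rfl⟩ := Sym2.mem_map.1 this
      exact hx (by rw [hρ])
    by_cases hx : ρ (g x) = x
    · by_cases hy : ρ (g y) = y
      · have : s(x, y) = Sym2.map ρ s(g x, g y) := by simp [hx, hy]
        rw [this, Multiset.count_map_eq_count' _ _ (Sym2.map.injective hinj), h2]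
        simp [hx, hy, pow_two]
      · rw [Sym2.eq_swap, hz y x hy]; simp [hy]
    · rw [hz x y hx]; simp [hx]
  · intro p
    rw [ce_map, Multiset.map_map]
    have : (Sym2.map g ∘ Sym2.map ρ) = id := by
      rw [← Sym2.map_comp]
      have : g ∘ ρ = id := funext hρ
      rw [this, Sym2.map_id]
    rw [this, Multiset.map_id, h2]
    have : Fact (1 < 2 * a + 1) := ⟨by omega⟩
    simp
  · intro v
    rw [hg, Finset.sum_eq_single (ρ (g v))]
    · simp [hρ]
    · intro x hx hne
      have hx : g x = g v := by simpa using hx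
      rw [hx, if_neg hne.symm]
    · intro h; simp [hρ] at h

lemma mem_pe_split {V : Type*} {l : List V} {e : Sym2 V} (h : e ∈ pe l) :
    ∃ l₁ x y l₂, l = l₁ ++ x :: y :: l₂ ∧ e = s(x, y) := by
  induction l with
  | nil => simp [pe] at h
  | cons x t ih =>
    cases t with
    | nil => simp [pe] at h
    | cons y t =>
      simp only [pe, Multiset.mem_cons] at h
      rcases h with rfl | h
      · exact ⟨[], x, y, t, rfl, rfl⟩
      · obtain ⟨l₁, x', y', l₂, h1, h2⟩ := ih h
        exact ⟨x :: l₁, x', y', l₂, by rw [h1]; rfl, h2⟩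

/-- Removing an edge from a closed walk leaves an open walk. -/
lemma ce_cut {V : Type*} {L : List V} {e : Sym2 V} (h : e ∈ ce L) :
    ∃ L' : List V, ce L = e ::ₘ pe L' ∧ (L' : Multiset V) = L := by
  cases L with
  | nil => simp [ce] at h
  | cons z t =>
    rw [ce] at h
    obtain ⟨l₁, x, y, l₂, h1, rfl⟩ := mem_pe_split h
    rcases List.eq_nil_or_concat l₂ with rfl | ⟨l₂, z', rfl⟩
    · have h3 : (z :: t) ++ [z] = (l₁ ++ [x]) ++ [y] := by simpa using h1
      obtain ⟨h4, h5⟩ := List.append_inj' h3 rfl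
      refine ⟨z :: t, ?_, rfl⟩
      rw [ce, ← List.cons_append, h3, List.append_assoc, List.singleton_append, pe_concat, ← h4,
        add_comm, Multiset.singleton_add]
    · have h3 : (z :: t) ++ [z] = (l₁ ++ x :: y :: l₂) ++ [z'] := by simpa using h1
      obtain ⟨h4, h5⟩ := List.append_inj' h3 rfl
      have hz : z' = z := by simpa using h5.symm
      subst hz
      rw [h4]
      have h6 : ce (z' :: t) = pe (l₁ ++ [x]) + (s(x, y) ::ₘ pe (y :: (l₂ ++ [z']))) := by
        rw [ce, h1, pe_append]; simp [pe]
      rw [← h4, h6]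
      cases l₁ with
      | nil =>
        have : z' = x := by simpa using (List.cons_eq_cons.1 h4).1
        subst this
        have : t = y :: l₂ := by simpa using h4
        subst this
        exact ⟨y :: (l₂ ++ [z']), by simp [pe], by
          rw [Multiset.coe_eq_coe, ← List.cons_append]
          exact List.perm_append_singleton _ _⟩
      | cons z'' l₁ =>
        have : z' = z'' := by simpa using (List.cons_eq_cons.1 h4).1
        subst this
        refine ⟨(y :: l₂) ++ (z' :: (l₁ ++ [x])), ?_, ?_⟩
        · rw [pe_append (y :: l₂)]
          simp only [← Multiset.singleton_add, List.cons_append]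
          abel
        · rw [h4, Multiset.coe_eq_coe]
          have : z' :: l₁ ++ x :: y :: l₂ = (z' :: (l₁ ++ [x])) ++ (y :: l₂) := by simp
          rw [this]
          exact List.perm_append_comm

lemma exists_walk {V : Type*} (G : SimpleGraph V) (l : List V) (hl : l ≠ [])
    (h : ∀ e ∈ pe l, e ∈ G.edgeSet) :
    ∃ (u v : V) (p : G.Walk u v), u = l.head hl ∧ p.support = l ∧ ∀ e, e ∈ p.edges ↔ e ∈ pe l := by
  induction l with
  | nil => simp at hl
  | cons x t ih =>
    cases t with
    | nil => exact ⟨x, x, .nil, rfl, by simp, by simp [pe]⟩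
    | cons y t =>
      simp only [pe, Multiset.mem_cons] at h
      obtain ⟨u, v, p, hu, hp1, hp2⟩ := ih (by simp) (fun e he => h e (Or.inr he))
      have hu : u = y := by simpa using hu
      subst hu
      have hadj : G.Adj x u := h _ (Or.inl rfl)
      refine ⟨x, v, .cons hadj p, rfl, by simp [hp1], ?_⟩
      intro e
      simp [pe, hp2]

lemma main {V : Type*} [Fintype V] [DecidableEq V] (a : ℕ) (ha : 1 ≤ a)
    (g : V → ZMod (2 * a + 1))
    (hg : ∀ i, (Finset.univ.filter (fun x => g x = i)).card = a) (G : SimpleGraph V)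
    (hG : ∀ x y, G.Adj x y ↔ (g x ≠ g y ∧ s(g x, g y) ≠ s(0, 1))) :
    G.HamiltonianPathDecomposition (a ^ 2) := by
  obtain ⟨w, L, hL⟩ := exists_init a ha g hg
  obtain ⟨L, hI⟩ := detach g s(0, 1) _ w L hL rfl
  have hcut : ∀ p, ∃ (e : Sym2 V) (L' : List V), Sym2.map g e = s(0, 1) ∧
      ce (L p) = e ::ₘ pe L' ∧ (L' : Multiset V) = L p := by
    intro p
    have h1 : s(0, 1) ∈ (ce (L p)).map (Sym2.map g) := by
      rw [← Multiset.count_pos, hI.fair]; omega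
    obtain ⟨e, he, he2⟩ := Multiset.mem_map.1 h1
    obtain ⟨L', h3, h4⟩ := ce_cut he
    exact ⟨e, L', he2, h3, h4⟩
  choose e₀ L' he₀ hce hco using hcut
  have hnot : ∀ p, ∀ e ∈ pe (L' p), Sym2.map g e ≠ s(0, 1) := by
    intro p e he hcon
    have h1 := hI.fair p
    rw [hce, Multiset.map_cons, he₀, Multiset.count_cons_self] at h1
    have h2 : s(0, 1) ∈ (pe (L' p)).map (Sym2.map g) := Multiset.mem_map.2 ⟨e, he, hcon⟩
    rw [← Multiset.count_pos] at h2
    omega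
  have hedge : ∀ p, ∀ e ∈ pe (L' p), e ∈ G.edgeSet := by
    intro p e he
    have h0 := hnot p e he
    induction e with
    | _ x y =>
      rw [SimpleGraph.mem_edgeSet, hG]
      refine ⟨?_, by simpa using h0⟩
      intro hxy
      have h1 := hI.edg x y
      rw [if_pos hxy, Finset.sum_eq_zero_iff] at h1
      have h2 := Multiset.count_eq_zero.1 (h1 p (Finset.mem_univ _))
      rw [hce] at h2
      exact h2 (Multiset.mem_cons_of_mem he)
  have hcnt : ∀ p x, (L' p).count x = 1 := by
    intro p x
    rw [← Multiset.coe_count, hco, Multiset.coe_count, hI.cnt]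
  have hnil : ∀ p, L' p ≠ [] := by
    intro p hp
    obtain ⟨x, -⟩ := Finset.card_pos.1 (by rw [hg 0]; omega)
    have := hcnt p x
    simp [hp] at this
  choose u v P hP1 hP2 hP3 using fun p => exists_walk G (L' p) (hnil p) (hedge p)
  refine ⟨u, v, P, ?_, ?_⟩
  · intro p x
    rw [hP2]
    convert hcnt p x
  · intro e he
    induction e with
    | _ x y =>
      rw [SimpleGraph.mem_edgeSet, hG] at he
      have h1 := hI.edg x y
      rw [if_neg he.1, one_mul] at h1
      have hmem : ∀ p, s(x, y) ∈ (P p).edges ↔ (ce (L p)).count s(x, y) ≠ 0 := by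
        intro p
        rw [hP3, Multiset.count_ne_zero, hce, Multiset.mem_cons]
        constructor
        · exact Or.inr
        · rintro (h | h)
          · exfalso
            apply he.2
            rw [← he₀ p, ← h]; rfl
          · exact h
      simp only [hmem]
      obtain ⟨p, -, hp⟩ : ∃ p ∈ Finset.univ, (ce (L p)).count s(x, y) ≠ 0 := by
        apply Finset.exists_ne_zero_of_sum_ne_zero
        rw [h1]; omega
      refine ⟨p, hp, fun q hq => ?_⟩
      by_contra hqp
      have h2 := Finset.add_le_sum (s := Finset.univ)
        (f := fun p => (ce (L p)).count s(x, y)) (fun _ _ => Nat.zero_le _)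
        (Finset.mem_univ q) (Finset.mem_univ p) hqp
      dsimp only at h2 hq hp
      omega

end HPD

/-- `K_{a^{2a-1},2a}` decomposes into `a²` Hamilton paths, for `a ≥ 1`. -/
theorem hamiltonianPathDecomposition_K_a_pow_twoASubOne_twoA
    (a : ℕ) (ha : 1 ≤ a) :
    (completeMultipartiteGraph
      (fun i : Fin (2 * a) => Fin (if (i : ℕ) = 0 then 2 * a else a))).HamiltonianPathDecomposition
      (a ^ 2) := by
  let gn : (Σ i : Fin (2 * a), Fin (if (i : ℕ) = 0 then 2 * a else a)) → ℕ := fun x =>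
    if (x.1 : ℕ) = 0 then (if (x.2 : ℕ) < a then 0 else 1) else (x.1 : ℕ) + 1
  have hlt : ∀ x, gn x < 2 * a + 1 := by
    intro x
    have := x.1.2
    by_cases h1 : (x.1 : ℕ) = 0 <;> by_cases h2 : (x.2 : ℕ) < a <;> simp [gn, h1, h2] <;> omega
  have hinj : ∀ m n : ℕ, m < 2 * a + 1 → n < 2 * a + 1 →
      ((m : ZMod (2 * a + 1)) = n ↔ m = n) := by
    intro m n hm hn
    rw [ZMod.natCast_eq_natCast_iff', Nat.mod_eq_of_lt hm, Nat.mod_eq_of_lt hn]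
  have h0 : ((0 : ℕ) : ZMod (2 * a + 1)) = 0 := by simp
  have h1 : ((1 : ℕ) : ZMod (2 * a + 1)) = 1 := by simp
  refine HPD.main a ha (fun x => (gn x : ZMod (2 * a + 1))) ?_ _ ?_
  · intro i
    obtain ⟨m, hm, rfl⟩ : ∃ m : ℕ, m < 2 * a + 1 ∧ (m : ZMod (2 * a + 1)) = i :=
      ⟨i.val, ZMod.val_lt i, by simp⟩
    have hiff : ∀ x, ((gn x : ZMod (2 * a + 1)) = m) ↔ gn x = m := fun x => hinj _ _ (hlt x) hm
    simp only [hiff]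
    -- index of the part and offset inside it
    let i₀ : ℕ := if m ≤ 1 then 0 else m - 1
    let o : ℕ := if m = 1 then a else 0
    have hi₀ : i₀ < 2 * a := by simp only [i₀]; split_ifs <;> omega
    have hb : ∀ t : Fin a, o + t < (if i₀ = 0 then 2 * a else a) := by
      intro t
      have := t.2
      simp only [i₀, o]; split_ifs <;> omega
    have hset : (Finset.univ.filter (fun x => gn x = m)) = Finset.univ.image
        (fun t : Fin a => (⟨⟨i₀, hi₀⟩, ⟨o + t, hb t⟩⟩ :
          Σ i : Fin (2 * a), Fin (if (i : ℕ) = 0 then 2 * a else a))) := by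
      ext ⟨⟨j, hj⟩, ⟨s, hs⟩⟩
      simp only [Finset.mem_filter, Finset.mem_univ, true_and, Finset.mem_image]
      constructor
      · intro h
        have hij : i₀ = j := by
          simp only [gn, i₀] at h ⊢
          split_ifs at h ⊢ <;> omega
        have hs' : o ≤ s ∧ s - o < a := by
          simp only [gn, o] at h ⊢
          dsimp only at hs
          split_ifs at h hs ⊢ <;> omega
        refine ⟨⟨s - o, hs'.2⟩, ?_⟩
        subst hij
        congr 2
        simp only
        omega
      · rintro ⟨t, ht⟩
        rw [← ht]
        have := t.2
        simp only [gn, i₀, o]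
        split_ifs <;> omega
    rw [hset, Finset.card_image_of_injective, Finset.card_univ, Fintype.card_fin]
    intro t t' htt
    simp only [Sigma.mk.injEq, heq_eq_eq, true_and, Fin.mk.injEq] at htt
    ext; omega
  · intro x y
    rw [Ne, hinj _ _ (hlt x) (hlt y), Ne, Sym2.eq_iff, ← h0, ← h1, hinj _ _ (hlt x) (by omega),
      hinj _ _ (hlt x) (by omega), hinj _ _ (hlt y) (by omega), hinj _ _ (hlt y) (by omega)]
    have hadj : (completeMultipartiteGraph
      (fun i : Fin (2 * a) => Fin (if (i : ℕ) = 0 then 2 * a else a))).Adj x y ↔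
        (x.1 : ℕ) ≠ (y.1 : ℕ) := by
      rw [Ne, ← Fin.ext_iff]
      rfl
    have hgn : ∀ z, ((z.1 : ℕ) = 0 ∧ (gn z = 0 ∨ gn z = 1)) ∨
        ((z.1 : ℕ) ≠ 0 ∧ gn z = (z.1 : ℕ) + 1) := by
      intro z
      by_cases hz : (z.1 : ℕ) = 0
      · by_cases hz2 : (z.2 : ℕ) < a <;> simp [gn, hz, hz2]
      · simp [gn, hz]
    rw [hadj]
    have hx := hgn x
    have hy := hgn y
    omega
end

section
/- Let K be an admissible complete multipartite graph with n > 1 vertices and m edges that is not a complete graph, and let t = m/(n−1). Then K has a proper edge colouring with 2t colours; in particular, the chromatic index of K equals its maximum degree 2t. -/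
namespace CMG

/-- A nonzero zero-sum perturbation supported on a set in which each line meets zero or
at least two entries. -/
lemma exists_perturb {I J : Type*} [Fintype I] [Fintype J] [DecidableEq I] [DecidableEq J]
    (F : Finset (I × J)) (hne : F.Nonempty)
    (hrow : ∀ e ∈ F, ∃ e' ∈ F, e'.1 = e.1 ∧ e' ≠ e)
    (hcol : ∀ e ∈ F, ∃ e' ∈ F, e'.2 = e.2 ∧ e' ≠ e) :
    ∃ z : I × J → ℚ, (∀ e, e ∉ F → z e = 0) ∧ (∃ e, z e ≠ 0) ∧
      (∀ i, ∑ j, z (i, j) = 0) ∧ (∀ j, ∑ i, z (i, j) = 0) := by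
  classical
  set R := F.image Prod.fst with hR
  set C := F.image Prod.snd with hC
  have hR2 : 2 * R.card ≤ F.card := by
    refine Finset.mul_card_image_le_card F 2 ?_
    intro r hr
    obtain ⟨e, he, rfl⟩ := Finset.mem_image.1 hr
    obtain ⟨e', he', h, hne⟩ := hrow e he
    exact Finset.one_lt_card.2 ⟨e, by simp [he], e', by simp [he', h], hne.symm⟩
  have hC2 : 2 * C.card ≤ F.card := by
    refine Finset.mul_card_image_le_card F 2 ?_
    intro r hr
    obtain ⟨e, he, rfl⟩ := Finset.mem_image.1 hr
    obtain ⟨e', he', h, hne⟩ := hcol e he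
    exact Finset.one_lt_card.2 ⟨e, by simp [he], e', by simp [he', h], hne.symm⟩
  obtain ⟨e0, he0⟩ := hne
  have hc0 : e0.2 ∈ C := Finset.mem_image_of_mem _ he0
  let ext : (F → ℚ) →ₗ[ℚ] (I × J → ℚ) :=
    { toFun := fun w e => if h : e ∈ F then w ⟨e, h⟩ else 0
      map_add' := by
        intro w w'; funext e; by_cases h : e ∈ F <;> simp [h]
      map_smul' := by
        intro r w; funext e; by_cases h : e ∈ F <;> simp [h] }
  have hext : ∀ w e, e ∉ F → ext w e = 0 := by
    intro w e he; simp [ext, he]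
  let L : (F → ℚ) →ₗ[ℚ] (R → ℚ) × ((C.erase e0.2 : Finset J) → ℚ) :=
    { toFun := fun w => (fun r => ∑ j, ext w (r.1, j), fun c => ∑ i, ext w (i, c.1))
      map_add' := by
        intro w w'; ext <;> simp [Finset.sum_add_distrib]
      map_smul' := by
        intro r w; ext <;> simp [Finset.mul_sum] }
  have hker : LinearMap.ker L ≠ ⊥ := by
    apply LinearMap.ker_ne_bot_of_finrank_lt
    simp only [Module.finrank_prod, Module.finrank_fintype_fun_eq_card, Fintype.card_coe]
    rw [Finset.card_erase_of_mem hc0]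
    have : 0 < C.card := Finset.card_pos.mpr ⟨_, hc0⟩
    omega
  obtain ⟨w, hw, hw0⟩ := (Submodule.ne_bot_iff _).1 hker
  rw [LinearMap.mem_ker] at hw
  have h1 : ∀ r : R, ∑ j, ext w (r.1, j) = 0 := fun r => congrFun (congrArg Prod.fst hw) r
  have h2 : ∀ c : (C.erase e0.2 : Finset J), ∑ i, ext w (i, c.1) = 0 :=
    fun c => congrFun (congrArg Prod.snd hw) c
  have h1' : ∀ i, ∑ j, ext w (i, j) = 0 := by
    intro i
    by_cases hi : i ∈ R
    · exact h1 ⟨i, hi⟩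
    · apply Finset.sum_eq_zero
      intro j _
      apply hext
      intro h
      exact hi (Finset.mem_image_of_mem Prod.fst h)
  have h2' : ∀ j, j ≠ e0.2 → ∑ i, ext w (i, j) = 0 := by
    intro j hj
    by_cases hi : j ∈ C
    · exact h2 ⟨j, Finset.mem_erase.2 ⟨hj, hi⟩⟩
    · apply Finset.sum_eq_zero
      intro i _
      apply hext
      intro h
      exact hi (Finset.mem_image_of_mem Prod.snd h)
  refine ⟨ext w, hext w, ?_, h1', ?_⟩
  · by_contra! h
    apply hw0
    funext e
    have := h e.1
    simpa [ext] using this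
  · intro j
    by_cases hj : j = e0.2
    · have : ∑ j, ∑ i, ext w (i, j) = 0 := by
        rw [Finset.sum_comm]; exact Finset.sum_eq_zero fun i _ => h1' i
      rw [Finset.sum_eq_single e0.2] at this
      · rw [hj]; exact this
      · intro j _ hj; exact h2' j hj
      · simp
    · exact h2' j hj


lemma exists_other_frac {J : Type*} [Fintype J] [DecidableEq J] (x : J → ℚ) (j : J)
    (hs : ∑ j, x j = 0) (hj : ¬ ∃ n : ℤ, (n : ℚ) = x j) :
    ∃ j', j' ≠ j ∧ ¬ ∃ n : ℤ, (n : ℚ) = x j' := by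
  by_contra! h
  apply hj
  choose! f hf using h
  refine ⟨-∑ j' ∈ Finset.univ.erase j, f j', ?_⟩
  rw [← Finset.add_sum_erase _ _ (Finset.mem_univ j)] at hs
  push_cast
  rw [Finset.sum_congr rfl (g := x)]
  · linarith
  · intro j' hj'; exact hf j' (Finset.ne_of_mem_erase hj')

lemma round_zero {I J : Type*} [Fintype I] [Fintype J] [DecidableEq I] [DecidableEq J] :
    ∀ (N : ℕ) (x : I × J → ℚ) (F : Finset (I × J)),
    (∀ e, e ∈ F ↔ ¬ ∃ n : ℤ, (n : ℚ) = x e) → F.card = N →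
    (∀ i, ∑ j, x (i, j) = 0) → (∀ j, ∑ i, x (i, j) = 0) →
    ∃ X : I × J → ℤ, (∀ e, ⌊x e⌋ ≤ X e ∧ X e ≤ ⌈x e⌉) ∧
      (∀ i, ∑ j, X (i, j) = 0) ∧ (∀ j, ∑ i, X (i, j) = 0) := by
  classical
  intro N
  induction N using Nat.strong_induction_on with
  | _ N ih =>
  intro x F hF hN hr hc
  by_cases hne : F.Nonempty
  swap
  · rw [Finset.not_nonempty_iff_eq_empty] at hne
    have : ∀ e, ∃ n : ℤ, (n : ℚ) = x e := by
      intro e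
      by_contra h
      have := (hF e).2 h
      simp [hne] at this
    choose X hX using this
    refine ⟨X, ?_, ?_, ?_⟩
    · intro e; rw [← hX]; simp
    · intro i; have := hr i; simp only [← hX] at this; exact_mod_cast this
    · intro i; have := hc i; simp only [← hX] at this; exact_mod_cast this
  obtain ⟨z, hz0, ⟨e1, he1⟩, hzr, hzc⟩ := exists_perturb F hne (by
      rintro ⟨i, j⟩ he
      obtain ⟨j', h1, h2⟩ := exists_other_frac (fun j => x (i, j)) j (hr i) ((hF _).1 he)
      exact ⟨(i, j'), (hF _).2 h2, rfl, by simpa using h1⟩) (by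
      rintro ⟨i, j⟩ he
      obtain ⟨j', h1, h2⟩ := exists_other_frac (fun i => x (i, j)) i (hc j) ((hF _).1 he)
      exact ⟨(j', j), (hF _).2 h2, rfl, by simpa using h1⟩)
  let tm : I × J → ℚ := fun e => if 0 < z e then (⌈x e⌉ - x e) / z e else (⌊x e⌋ - x e) / z e
  obtain ⟨e2, he2, hmin⟩ := Finset.exists_min_image (Finset.univ.filter fun e => z e ≠ 0) tm
    ⟨e1, by simpa using he1⟩
  simp only [Finset.mem_filter, Finset.mem_univ, true_and] at he2 hmin
  have hpos : 0 ≤ tm e2 := by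
    simp only [tm]
    split_ifs with h
    · exact div_nonneg (by linarith [Int.le_ceil (x e2)]) h.le
    · exact div_nonneg_of_nonpos (by linarith [Int.floor_le (x e2)]) (not_lt.1 h)
  set ε := tm e2 with hε
  let x' : I × J → ℚ := fun e => x e + ε * z e
  have hbd : ∀ e, (⌊x e⌋ : ℚ) ≤ x' e ∧ x' e ≤ ⌈x e⌉ := by
    intro e
    have hf := Int.floor_le (x e)
    have hc := Int.le_ceil (x e)
    by_cases hze : z e = 0
    · simp [x', hze, hf, hc]
    have := hmin e hze
    simp only [tm] at this
    split_ifs at this with h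
    · rw [le_div_iff₀ h] at this
      have : 0 ≤ ε * z e := mul_nonneg hpos h.le
      constructor <;> simp only [x'] <;> linarith
    · have h' : z e < 0 := lt_of_le_of_ne (not_lt.1 h) hze
      rw [le_div_iff_of_neg h'] at this
      have : ε * z e ≤ 0 := mul_nonpos_of_nonneg_of_nonpos hpos h'.le
      constructor <;> simp only [x'] <;> linarith
  have hIntg : ∃ n : ℤ, (n : ℚ) = x' e2 := by
    simp only [x', hε, tm]
    split_ifs with h
    · exact ⟨⌈x e2⌉, by field_simp; ring⟩
    · exact ⟨⌊x e2⌋, by field_simp; ring⟩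
  let F' := Finset.univ.filter fun e => ¬ ∃ n : ℤ, (n : ℚ) = x' e
  have hlt : F'.card < F.card := by
    apply Finset.card_lt_card
    rw [Finset.ssubset_iff_of_subset]
    · refine ⟨e2, ?_, ?_⟩
      · by_contra h; exact he2 (hz0 _ h)
      · simp only [F', Finset.mem_filter, Finset.mem_univ, true_and, not_not]; exact hIntg
    · intro e he
      by_contra h
      simp only [F', Finset.mem_filter, Finset.mem_univ, true_and] at he
      apply he
      have h2 := mt (hF e).2 h
      rw [not_not] at h2
      simpa [x', hz0 e h] using h2
  obtain ⟨X, hX, h1, h2⟩ := ih F'.card (hN ▸ hlt) x' F' (by simp [F']) rfl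
    (by intro i; simp [x', Finset.sum_add_distrib, ← Finset.mul_sum, hr, hzr])
    (by intro i; simp [x', Finset.sum_add_distrib, ← Finset.mul_sum, hc, hzc])
  refine ⟨X, fun e => ⟨?_, ?_⟩, h1, h2⟩
  · exact (Int.le_floor.2 (hbd e).1).trans (hX e).1
  · exact (hX e).2.trans (Int.ceil_le.2 (hbd e).2)

/-- Rounding lemma for matrices. -/
lemma round {I J : Type*} [Fintype I] [Fintype J] [DecidableEq I] [DecidableEq J]
    (x : I → J → ℚ) :
    ∃ X : I → J → ℤ, (∀ i j, ⌊x i j⌋ ≤ X i j ∧ X i j ≤ ⌈x i j⌉) ∧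
      (∀ i, ⌊∑ j, x i j⌋ ≤ ∑ j, X i j ∧ ∑ j, X i j ≤ ⌈∑ j, x i j⌉) ∧
      (∀ j, ⌊∑ i, x i j⌋ ≤ ∑ i, X i j ∧ ∑ i, X i j ≤ ⌈∑ i, x i j⌉) := by
  classical
  let y : Option I × Option J → ℚ := fun e => match e with
    | (some i, some j) => x i j
    | (some i, none) => - ∑ j, x i j
    | (none, some j) => - ∑ i, x i j
    | (none, none) => ∑ i, ∑ j, x i j
  obtain ⟨X, h0, h1, h2⟩ := round_zero _ y (Finset.univ.filter fun e => ¬ ∃ n : ℤ, (n : ℚ) = y e)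
    (by simp) rfl (by
      intro i
      rw [Fintype.sum_option]
      cases i with
      | none => simp only [y]; rw [Finset.sum_comm]; simp
      | some i => simp [y]) (by
      intro i
      rw [Fintype.sum_option]
      cases i with
      | none => simp [y]
      | some i => simp [y])
  refine ⟨fun i j => X (some i, some j), fun i j => h0 (some i, some j), fun i => ?_, fun j => ?_⟩
  · have a := h0 (some i, none)
    have b := h1 (some i)
    rw [Fintype.sum_option] at b
    simp only [y, Int.floor_neg, Int.ceil_neg] at a
    constructor <;> linarith [a.1, a.2]
  · have a := h0 (none, some j)
    have b := h2 (some j)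
    rw [Fintype.sum_option] at b
    simp only [y, Int.floor_neg, Int.ceil_neg] at a
    constructor <;> linarith [a.1, a.2]

lemma split_one {K W : Type*} [Fintype K] [DecidableEq K] [Fintype W] [DecidableEq W]
    (c : K → W → ℤ) (x : W) (η : ℤ) (hη : 2 ≤ η) (S : W → ℤ) (D : ℤ)
    (hc : ∀ k y, 0 ≤ c k y) (hev : ∀ k, Even (c k x))
    (hS : ∀ y, ∑ k, c k y = η * S y) (hD : ∀ k, ∑ y, c k y ≤ η * D) :
    ∃ Z : K → W → ℤ, (∀ k y, 0 ≤ Z k y) ∧ (∀ k y, Z k y ≤ c k y) ∧ (∀ k, 2 * Z k x ≤ c k x) ∧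
      (∀ y, ∑ k, Z k y = S y) ∧ (∀ k, ∑ y, Z k y ≤ D) ∧
      (∀ k, ∑ y, c k y - ∑ y, Z k y ≤ (η - 1) * D) := by
  have hη0 : (0 : ℚ) < η := by exact_mod_cast (by omega : 0 < η)
  have hη1 : (2 : ℚ) ≤ η := by exact_mod_cast hη
  obtain ⟨Z, h0, h1, h2⟩ := round (fun k y => (c k y : ℚ) / η)
  refine ⟨Z, ?_, ?_, ?_, ?_, ?_, ?_⟩
  · intro k y
    refine le_trans ?_ (h0 k y).1
    rw [Int.floor_nonneg]
    exact div_nonneg (by exact_mod_cast hc k y) hη0.le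
  · intro k y
    refine (h0 k y).2.trans ?_
    rw [Int.ceil_le, div_le_iff₀ hη0]
    have : (0 : ℚ) ≤ c k y := by exact_mod_cast hc k y
    nlinarith
  · intro k
    obtain ⟨r, hr⟩ := hev k
    have hr0 : 0 ≤ r := by have := hc k x; omega
    have : Z k x ≤ r := by
      refine (h0 k x).2.trans ?_
      rw [Int.ceil_le, div_le_iff₀ hη0, hr]
      have : (0 : ℚ) ≤ r := by exact_mod_cast hr0
      push_cast
      nlinarith
    omega
  · intro y
    have h := h2 y
    have e : ∑ k, (c k y : ℚ) / η = (S y : ℤ) := by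
      rw [← Finset.sum_div, div_eq_iff hη0.ne']
      have := hS y
      rw [mul_comm] at this
      exact_mod_cast this
    rw [e, Int.floor_intCast, Int.ceil_intCast] at h
    omega
  · intro k
    refine (h1 k).2.trans ?_
    rw [Int.ceil_le, ← Finset.sum_div, div_le_iff₀ hη0]
    have := hD k
    rw [mul_comm] at this
    exact_mod_cast this
  · intro k
    have h := (h1 k).1
    rw [← Finset.sum_div] at h
    have h' : (∑ y, (c k y : ℚ)) / η < ∑ y, Z k y + 1 := by
      have := Int.lt_floor_add_one ((∑ y, (c k y : ℚ)) / η)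
      have h3 : ((⌊(∑ y, (c k y : ℚ)) / η⌋ : ℤ) : ℚ) ≤ ((∑ y, Z k y : ℤ) : ℚ) := by
        exact_mod_cast h
      linarith
    rw [div_lt_iff₀ hη0] at h'
    have h4 : ∑ y, c k y < (∑ y, Z k y + 1) * η := by exact_mod_cast h'
    have h5 := hD k
    set s := ∑ y, c k y
    set z := ∑ y, Z k y
    by_cases hz : D ≤ z
    · nlinarith
    · have : z + 1 ≤ D := by omega
      nlinarith

theorem detach {K : Type*} [Fintype K] [DecidableEq K] {U : Type*} [Fintype U] [DecidableEq U] :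
    ∀ (N : ℕ) {W : Type*} [Fintype W] [DecidableEq W] (φ : U → W) (η : W → ℤ)
      (lam : W → W → ℤ) (D : W → ℤ) (c : K → W → W → ℤ),
      Fintype.card U - (Finset.univ.image φ).card = N →
      (∀ x, η x = (Finset.univ.filter fun u => φ u = x).card) →
      (∀ k x y, 0 ≤ c k x y) → (∀ k x y, c k x y = c k y x) → (∀ x y, lam x y = lam y x) →
      (∀ x y, x ≠ y → ∑ k, c k x y = η x * (lam x y * η y)) →
      (∀ x, ∑ k, c k x x = η x * (lam x x * (η x - 1))) →
      (∀ k x, Even (c k x x)) →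
      (∀ k x, ∑ y, c k x y ≤ η x * D x) →
      ∃ C : K → U → U → ℤ, (∀ k u v, 0 ≤ C k u v) ∧ (∀ k u v, C k u v = C k v u) ∧
        (∀ k u, C k u u = 0) ∧ (∀ u v, u ≠ v → ∑ k, C k u v = lam (φ u) (φ v)) ∧
        (∀ k u, ∑ v, C k u v ≤ D (φ u)) := by
  classical
  intro N
  induction N with
  | zero =>
    intro W _ _ φ η lam D c hN hη hc0 hcs hls hcl hcl' hev hdeg
    have hinj : Function.Injective φ := by
      have h1 := Finset.card_image_le (s := Finset.univ) (f := φ)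
      rw [Finset.card_univ] at h1
      have : (Finset.univ.image φ).card = (Finset.univ : Finset U).card := by
        rw [Finset.card_univ]; omega
      rw [Finset.card_image_iff] at this
      exact Set.injOn_univ.1 (by simpa using this)
    have hη1 : ∀ u, η (φ u) = 1 := by
      intro u
      rw [hη]
      have : (Finset.univ.filter fun v => φ v = φ u) = {u} := by
        ext v; simp [hinj.eq_iff]
      rw [this]; simp
    refine ⟨fun k u v => if u = v then 0 else c k (φ u) (φ v), ?_, ?_, ?_, ?_, ?_⟩
    · intro k u v; dsimp only; split_ifs; exacts [le_rfl, hc0 _ _ _]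
    · intro k u v; simp only [eq_comm (a := u) (b := v)]; rw [hcs]
    · simp
    · intro u v huv
      simp only [huv, if_false]
      rw [hcl _ _ (hinj.ne huv), hη1, hη1]; ring
    · intro k u
      have h := hdeg k (φ u)
      rw [hη1, one_mul] at h
      refine le_trans ?_ h
      calc ∑ v, (if u = v then 0 else c k (φ u) (φ v)) ≤ ∑ v, c k (φ u) (φ v) := by
            apply Finset.sum_le_sum; intro v _; split_ifs; exacts [hc0 _ _ _, le_rfl]
        _ = ∑ y ∈ Finset.univ.image φ, c k (φ u) y := by
            rw [Finset.sum_image]; intro a _ b _ h; exact hinj h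
        _ ≤ ∑ y, c k (φ u) y :=
            Finset.sum_le_sum_of_subset_of_nonneg (Finset.subset_univ _) (fun y _ _ => hc0 _ _ _)
  | succ N ih =>
    intro W _ _ φ η lam D c hN hη hc0 hcs hls hcl hcl' hev hdeg
    have hninj : ¬ Function.Injective φ := by
      intro h
      rw [Finset.card_image_of_injective _ h, Finset.card_univ] at hN
      omega
    obtain ⟨u0, u1, h01, hu⟩ : ∃ u0 u1, φ u0 = φ u1 ∧ u0 ≠ u1 := by
      simpa [Function.Injective] using hninj
    set x := φ u0 with hx
    have hη2 : 2 ≤ η x := by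
      rw [hη]
      exact_mod_cast Finset.one_lt_card.2 ⟨u0, by simp [hx], u1, by simp [← h01], hu⟩
    obtain ⟨Z, hZ0, hZc, hZ2, hZS, hZD, hZr⟩ := split_one (fun k y => c k x y) x (η x) hη2
      (fun y => lam x y * (if y = x then η x - 1 else η y)) (D x) (fun k y => hc0 k x y)
      (fun k => hev k x) (by
        intro y
        by_cases h : y = x
        · subst h; simp only [if_true]; exact hcl' _
        · simp only [h, if_false]; exact hcl _ _ (Ne.symm h)) (fun k => hdeg k x)
    let φ' : U → Option W := fun u => if u = u0 then none else some (φ u)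
    let π : Option W → W := fun o => o.getD x
    let c' : K → Option W → Option W → ℤ := fun k o o' => match o, o' with
      | none, none => 0
      | none, some y => Z k y
      | some y, none => Z k y
      | some y, some y' =>
        c k y y' - (if y = x then Z k y' else 0) - (if y' = x then Z k y else 0)
    let η' : Option W → ℤ := fun o => match o with
      | none => 1
      | some y => η y - if y = x then 1 else 0
    obtain ⟨C, hC⟩ := ih φ' η' (fun o o' => lam (π o) (π o')) (fun o => D (π o)) c'
      (by
        have : Finset.univ.image φ' = insert none ((Finset.univ.image φ).image some) := by
          ext o
          cases o with
          | none => simp [φ']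
          | some y =>
            simp only [φ', Finset.mem_image, Finset.mem_univ, true_and, Finset.mem_insert,
              reduceCtorEq, false_or, Option.some.injEq, exists_eq_right]
            constructor
            · rintro ⟨u, hw⟩
              split_ifs at hw with h
              exact ⟨u, by simpa using hw⟩
            · rintro ⟨u, hw⟩
              by_cases h : u = u0
              · refine ⟨u1, ?_⟩
                rw [if_neg hu.symm, ← h01, ← hw, h, hx]
              · exact ⟨u, by simp [h, hw]⟩
        rw [this, Finset.card_insert_of_notMem (by simp),
          Finset.card_image_of_injective _ (Option.some_injective _)]
        omega)
      (by
        intro o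
        cases o with
        | none =>
          have : (Finset.univ.filter fun u => φ' u = none) = {u0} := by
            ext u; simp [φ']
          rw [this]; simp [η']
        | some y =>
          have : (Finset.univ.filter fun u => φ' u = some y)
              = (Finset.univ.filter fun u => φ u = y).erase u0 := by
            ext u; by_cases h : u = u0 <;> simp [φ', h]
          rw [this]
          simp only [η', hη]
          by_cases h : y = x
          · rw [Finset.card_erase_of_mem (by simp [h, hx])]
            have h3 : 0 < (Finset.univ.filter fun u => φ u = y).card :=
              Finset.card_pos.2 ⟨u0, by simp [h, hx]⟩
            rw [if_pos h]; omega
          · rw [Finset.erase_eq_of_notMem (by simp [← hx, Ne.symm h])]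
            simp [h])
      (by
        intro k o o'
        rcases o with _ | y <;> rcases o' with _ | y'
        · exact le_rfl
        · exact hZ0 _ _
        · exact hZ0 _ _
        · simp only [c']
          split_ifs with h1 h2 h2
          · subst h1; subst h2; have := hZ2 k; omega
          · rw [h1]; have := hZc k y'; omega
          · rw [h2]; have := hZc k y; rw [hcs] at this; omega
          · have := hc0 k y y'; omega)
      (by
        intro k o o'
        rcases o with _ | y <;> rcases o' with _ | y' <;> simp only [c']
        rw [hcs]; ring)
      (by intro o o'; exact hls _ _)
      (by
        intro o o' hoo
        rcases o with _ | y <;> rcases o' with _ | y' <;> simp only [c', η', π, Option.getD_none,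
          Option.getD_some]
        · exact absurd rfl hoo
        · rw [hZS]; by_cases h : y' = x
          · subst h; simp
          · simp [h]
        · rw [hZS, hls]; by_cases h : y = x
          · subst h; simp; ring
          · simp [h]; ring
        · have hyy : y ≠ y' := fun h => hoo (by rw [h])
          rw [Finset.sum_sub_distrib, Finset.sum_sub_distrib, hcl _ _ hyy]
          by_cases h1 : y = x
          · have h2 : y' ≠ x := fun h => hyy (h1.trans h.symm)
            simp only [h1, h2, if_true, if_false, hZS, Finset.sum_const_zero]; ring
          · by_cases h2 : y' = x
            · simp only [h1, h2, if_true, if_false, hZS, Finset.sum_const_zero, hls x y]; ring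
            · simp [h1, h2])
      (by
        intro o
        rcases o with _ | y <;> simp only [c', η', π, Option.getD_none, Option.getD_some]
        · simp
        · rw [Finset.sum_sub_distrib, Finset.sum_sub_distrib, hcl']
          by_cases h1 : y = x
          · simp only [h1, if_true, hZS]; ring
          · simp [h1])
      (by
        intro k o
        rcases o with _ | y <;> simp only [c']
        · exact Even.zero
        · by_cases h1 : y = x
          · have := hev k y
            rw [if_pos h1]
            rw [Int.even_iff] at *
            omega
          · simpa [h1] using hev k y)
      (by
        intro k o
        rw [Fintype.sum_option]
        rcases o with _ | y <;> simp only [c', η', π, Option.getD_none, Option.getD_some]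
        · simpa using hZD k
        · rw [Finset.sum_sub_distrib, Finset.sum_sub_distrib]
          by_cases h1 : y = x
          · simp only [h1, if_true, Finset.sum_ite_eq', Finset.mem_univ]
            have := hZr k
            linarith
          · simp only [h1, if_false, Finset.sum_ite_eq', Finset.mem_univ, if_true,
              Finset.sum_const_zero]
            have := hdeg k y
            linarith)
    have hπ : ∀ u, π (φ' u) = φ u := by
      intro u
      by_cases h : u = u0
      · simp [φ', π, h, hx]
      · simp [φ', π, h]
    refine ⟨C, hC.1, hC.2.1, hC.2.2.1, ?_, ?_⟩
    · intro u v huv; rw [hC.2.2.2.1 u v huv, hπ, hπ]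
    · intro k u; have := hC.2.2.2.2 k u; rwa [hπ] at this

end CMG

namespace CMG

lemma parity_adjust {K : Type*} [Fintype K] [DecidableEq K] : ∀ (r : ℕ) (m : K → ℤ) (N : ℤ),
    (∀ k, 0 ≤ m k) → ∑ k, m k % 2 ≤ N → ∑ k, m k = N + 2 * r →
    ∃ β : K → ℤ, (∀ k, 0 ≤ β k) ∧ (∀ k, β k ≤ m k) ∧ (∀ k, β k % 2 = m k % 2) ∧
      ∑ k, β k = N := by
  intro r
  induction r with
  | zero => intro m N h0 h1 h2; exact ⟨m, h0, fun _ => le_rfl, fun _ => rfl, by simpa using h2⟩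
  | succ r ih =>
    intro m N h0 h1 h2
    obtain ⟨k0, hk0⟩ : ∃ k, 2 ≤ m k := by
      by_contra! h
      have : ∑ k, m k % 2 = ∑ k, m k := by
        apply Finset.sum_congr rfl
        intro k _
        have := h k
        have := h0 k
        omega
      push_cast at h2
      omega
    obtain ⟨β, hb0, hb1, hb2, hb3⟩ := ih (fun k => m k - if k = k0 then 2 else 0) N
      (by intro k; split_ifs with h
          · rw [h]; omega
          · have := h0 k; omega)
      (by
        refine le_trans (le_of_eq ?_) h1
        apply Finset.sum_congr rfl
        intro k _
        split_ifs <;> omega)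
      (by rw [Finset.sum_sub_distrib, h2]; simp; ring)
    refine ⟨β, hb0, ?_, ?_, hb3⟩
    · intro k; have := hb1 k; split_ifs at this <;> omega
    · intro k; have := hb2 k; split_ifs at this <;> omega

lemma even_sum_sym {G : Type*} [Fintype G] [DecidableEq G] (c : G → G → ℤ)
    (hs : ∀ u v, c u v = c v u) (hd : ∀ u, c u u = 0) : Even (∑ u, ∑ v, c u v) := by
  rw [← ZMod.intCast_eq_zero_iff_even]
  push_cast
  rw [← Fintype.sum_prod_type']
  apply Finset.sum_involution (fun x _ => (x.2, x.1))
  · rintro ⟨u, v⟩ _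
    dsimp only
    rw [hs v u]
    exact CharTwo.add_self_eq_zero _
  · rintro ⟨u, v⟩ _ h h2
    simp only [Prod.mk.injEq] at h2
    apply h
    simp [h2.1, hd]
  · simp
  · simp

/-- Adjacency indicator of a complete multipartite graph. -/
def ad {G P : Type*} [DecidableEq P] (part : G → P) (u v : G) : ℤ := if part u = part v then 0 else 1

/-- Size of the part of a vertex. -/
def psz {G P : Type*} [Fintype G] [DecidableEq P] (part : G → P) (v : G) : ℤ :=
  ((Finset.univ.filter fun u => part v = part u).card : ℤ)

lemma sum_ad {G P : Type*} [Fintype G] [DecidableEq P] (part : G → P) (v : G) :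
    ∑ u, ad part v u = Fintype.card G - psz part v := by
  have : ∀ u, ad part v u = 1 - if part v = part u then 1 else 0 := by
    intro u; unfold ad; split_ifs <;> simp
  simp only [this, Finset.sum_sub_distrib, psz]
  simp

lemma base {K G P : Type*} [Fintype K] [DecidableEq K] [Fintype G] [DecidableEq G]
    [DecidableEq P] (part : G → P) (a nA nB : ℤ)
    (ck : K → G → G → ℤ) (hck0 : ∀ k u v, 0 ≤ ck k u v) (hcks : ∀ k u v, ck k u v = ck k v u)
    (hckad : ∀ u v, ∑ k, ck k u v = ad part u v)
    (m : K → G → ℤ) (hm0 : ∀ k v, 0 ≤ m k v) (hm : ∀ v, ∑ k, m k v = psz part v - a)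
    (d : K → ℤ) (hd0 : ∀ k, 0 ≤ d k) (hd : ∑ k, d k = nB)
    (Z : K → G → ℤ) (hZ0 : ∀ k v, 0 ≤ Z k v)
    (hZ1 : ∀ k v, Z k v ≤ 1 - m k v - ∑ u, ck k v u) (hZ : ∀ v, ∑ k, Z k v = nB)
    (hK : (Fintype.card K : ℤ) = nA + nB + Fintype.card G - a)
    (hKe : Even (Fintype.card K : ℤ)) (hpar : ∀ k, Even (∑ v, m k v + d k - a))
    (hg : ∀ k, 0 ≤ nB - d k - ∑ v, Z k v) (hGA : (Fintype.card G : ℤ) ≤ nA)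
    (hmin : nA * nB ≤ ∑ k, min (nB - d k - ∑ v, Z k v)
      (nA - ∑ v, (1 - m k v - ∑ u, ck k v u) + ∑ v, Z k v))
    (hmod : ∑ k, (nB - d k - ∑ v, Z k v) % 2 ≤ nA * nB)
    (hBe : Even (nB * (nB - (a + 1)))) :
    ∃ c : K → G ⊕ Bool → G ⊕ Bool → ℤ,
      (∀ k x y, 0 ≤ c k x y) ∧ (∀ k x y, c k x y = c k y x) ∧ (∀ k x, Even (c k x x)) ∧
      (∀ u v, ∑ k, c k (.inl u) (.inl v) = ad part u v) ∧
      (∀ v, ∑ k, c k (.inl v) (.inr false) = nA) ∧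
      (∀ v, ∑ k, c k (.inl v) (.inr true) = nB) ∧
      (∑ k, c k (.inr false) (.inr false) = nA * (nA - a)) ∧
      (∑ k, c k (.inr false) (.inr true) = nA * nB) ∧
      (∑ k, c k (.inr true) (.inr true) = nB * (nB - (a + 1))) ∧
      (∀ k v, ∑ y, c k (.inl v) y ≤ 1) ∧
      (∀ k, ∑ y, c k (.inr false) y ≤ nA) ∧
      (∀ k, ∑ y, c k (.inr true) y ≤ nB) := by
  classical
  have hckd : ∀ k v, ck k v v = 0 := by
    intro k v
    have h := hckad v v
    simp only [ad, if_true] at h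
    exact (Finset.sum_eq_zero_iff_of_nonneg (fun k _ => hck0 k v v)).1 h k (Finset.mem_univ _)
  set Y : K → G → ℤ := fun k v => 1 - m k v - ∑ u, ck k v u with hY
  set g : K → ℤ := fun k => nB - d k - ∑ v, Z k v with hgdef
  set h : K → ℤ := fun k => nA - ∑ v, Y k v + ∑ v, Z k v with hhdef
  have hYsum : ∀ v, ∑ k, Y k v = nA + nB := by
    intro v
    simp only [hY, Finset.sum_sub_distrib]
    rw [Finset.sum_comm, hm]
    simp only [hckad]
    rw [sum_ad]
    simp [hK]
  have hy : ∀ k, ∑ v, Y k v = Fintype.card G - ∑ v, m k v - ∑ v, ∑ u, ck k v u := by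
    intro k; simp [hY, Finset.sum_sub_distrib]
  have hh0 : ∀ k, 0 ≤ h k := by
    intro k
    have h1 : ∑ v, Y k v ≤ Fintype.card G := by
      rw [hy]
      have := Finset.sum_nonneg (fun v (_ : v ∈ Finset.univ) => hm0 k v)
      have := Finset.sum_nonneg (fun v (_ : v ∈ Finset.univ) =>
        Finset.sum_nonneg (fun u (_ : u ∈ Finset.univ) => hck0 k v u))
      linarith
    have := Finset.sum_nonneg (fun v (_ : v ∈ Finset.univ) => hZ0 k v)
    simp only [hhdef]
    linarith
  have hgh : ∀ k, g k % 2 = h k % 2 := by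
    intro k
    have h1 := hpar k
    have h2 := even_sum_sym (ck k) (hcks k) (hckd k)
    simp only [hgdef, hhdef, hy]
    rw [Int.even_iff] at *
    omega
  have hgs : ∑ k, g k = nA * nB + nB * (nB - (a + 1)) := by
    simp only [hgdef, Finset.sum_sub_distrib, hd]
    rw [Finset.sum_comm]
    simp only [hZ]
    simp [hK]
    ring
  have hhs : ∑ k, h k = nA * nB + nA * (nA - a) := by
    simp only [hhdef, Finset.sum_add_distrib, Finset.sum_sub_distrib]
    rw [Finset.sum_comm (f := fun k v => Z k v), Finset.sum_comm (f := fun k v => Y k v)]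
    simp only [hZ, hYsum]
    simp [hK]
    ring
  set mn : K → ℤ := fun k => min (g k) (h k) with hmn
  have hmn2 : ∀ k, mn k % 2 = g k % 2 := by
    intro k; have := hgh k; simp only [hmn]; omega
  obtain ⟨r, hr⟩ : ∃ r : ℕ, ∑ k, mn k = nA * nB + 2 * r := by
    have e1 : Even (∑ k, g k - ∑ k, mn k) := by
      rw [← Finset.sum_sub_distrib]
      apply Finset.even_sum
      intro k _
      rw [Int.even_iff]
      have := hmn2 k
      omega
    have e2 : Even (∑ k, mn k - nA * nB) := by
      rw [hgs] at e1
      rw [Int.even_iff] at *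
      omega
    obtain ⟨r, hr⟩ := e2
    refine ⟨r.toNat, ?_⟩
    have : nA * nB ≤ ∑ k, mn k := hmin
    omega
  obtain ⟨β, hb0, hb1, hb2, hb3⟩ := parity_adjust r mn (nA * nB)
    (by intro k; exact le_min (hg k) (hh0 k))
    (by simp only [hmn2]; exact hmod) hr
  have hbg : ∀ k, β k ≤ g k := fun k => (hb1 k).trans (min_le_left _ _)
  have hbh : ∀ k, β k ≤ h k := fun k => (hb1 k).trans (min_le_right _ _)
  refine ⟨fun k x y => match x, y with
    | .inl u, .inl v => ck k u v
    | .inl v, .inr true => Z k v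
    | .inr true, .inl v => Z k v
    | .inl v, .inr false => Y k v - Z k v
    | .inr false, .inl v => Y k v - Z k v
    | .inr false, .inr false => h k - β k
    | .inr false, .inr true => β k
    | .inr true, .inr false => β k
    | .inr true, .inr true => g k - β k, ?_, ?_, ?_, ?_, ?_, ?_, ?_, ?_, ?_, ?_, ?_, ?_⟩
  · rintro k (u | _ | _) (v | _ | _)
    · exact hck0 _ _ _
    · exact sub_nonneg.2 (hZ1 k u)
    · exact hZ0 _ _
    · exact sub_nonneg.2 (hZ1 k v)
    · exact sub_nonneg.2 (hbh k)
    · exact hb0 k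
    · exact hZ0 _ _
    · exact hb0 k
    · exact sub_nonneg.2 (hbg k)
  · rintro k (u | _ | _) (v | _ | _) <;> first | rfl | exact hcks _ _ _
  · rintro k (u | _ | _)
    · simp [hckd]
    · have := hb2 k; have := hgh k; have := hmn2 k; simp only [Int.even_iff]; omega
    · have := hb2 k; have := hgh k; have := hmn2 k; simp only [Int.even_iff]; omega
  · exact hckad
  · intro v; simp only [Finset.sum_sub_distrib, hYsum, hZ]; ring
  · exact hZ
  · simp only [Finset.sum_sub_distrib, hhs, hb3]; ring
  · exact hb3
  · simp only [Finset.sum_sub_distrib, hgs, hb3]; ring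
  · intro k v
    simp only [Fintype.sum_sum_type, Fintype.sum_bool]
    have := hm0 k v
    simp only [hY]
    linarith
  · intro k
    simp only [Fintype.sum_sum_type, Fintype.sum_bool, Finset.sum_sub_distrib]
    simp only [hhdef]
    linarith
  · intro k
    simp only [Fintype.sum_sum_type, Fintype.sum_bool]
    simp only [hgdef]
    have := hd0 k
    linarith

end CMG

namespace CMG

lemma greedy_aux {K G : Type*} [Fintype K] [DecidableEq K] [Fintype G] [DecidableEq G]
    (H : SimpleGraph G) [DecidableRel H.Adj] [Nonempty K] (M : G → Finset K)
    (hM : ∀ u v, H.Adj u v →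
      (M u).card + (M v).card + H.degree u + H.degree v < Fintype.card K + 2) :
    ∀ E : Finset (Sym2 G), E ⊆ H.edgeFinset → ∃ col : Sym2 G → K,
      ∀ e ∈ E, ∀ v ∈ e, col e ∉ M v ∧ ∀ f ∈ E, v ∈ f → e ≠ f → col e ≠ col f := by
  classical
  intro E
  induction E using Finset.induction_on with
  | empty =>
    intro _
    exact ⟨fun _ => Classical.arbitrary K, by simp⟩
  | insert e E he ih =>
    intro hE
    obtain ⟨col, hcol⟩ := ih ((Finset.subset_insert _ _).trans hE)
    have heH : e ∈ H.edgeFinset := hE (Finset.mem_insert_self _ _)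
    induction e using Sym2.ind with
    | _ u v =>
    have huv : H.Adj u v := by simpa using heH
    have hinc : ∀ w ∈ s(u, v), (E.filter fun f => w ∈ f).card + 1 ≤ H.degree w := by
      intro w hw
      rw [← SimpleGraph.card_incidenceFinset_eq_degree, ← Finset.card_insert_of_notMem
        (s := E.filter fun f => w ∈ f) (a := s(u, v)) (by simp [he])]
      apply Finset.card_le_card
      intro f hf
      rw [SimpleGraph.mem_incidenceFinset]
      rw [Finset.mem_insert, Finset.mem_filter] at hf
      rcases hf with rfl | ⟨h1, h2⟩
      · exact ⟨huv, hw⟩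
      · exact ⟨by simpa using hE (Finset.mem_insert_of_mem h1), h2⟩
    let bad : Finset K := M u ∪ M v ∪ (E.filter fun f => u ∈ f).image col ∪
      (E.filter fun f => v ∈ f).image col
    have hbad : bad.card < Fintype.card K := by
      have h1 := hinc u (by simp)
      have h2 := hinc v (by simp)
      have h3 := hM u v huv
      have h4 : bad.card ≤ (M u).card + (M v).card + (E.filter fun f => u ∈ f).card +
          (E.filter fun f => v ∈ f).card := by
        refine (Finset.card_union_le _ _).trans ?_
        refine add_le_add ?_ Finset.card_image_le
        refine (Finset.card_union_le _ _).trans ?_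
        exact add_le_add (Finset.card_union_le _ _) Finset.card_image_le
      omega
    obtain ⟨k, hk⟩ : ∃ k, k ∉ bad := by
      by_contra! h
      rw [Finset.eq_univ_of_forall h, Finset.card_univ] at hbad
      omega
    simp only [bad, Finset.mem_union, Finset.mem_image, Finset.mem_filter, not_or, not_exists,
      not_and, and_imp] at hk
    obtain ⟨⟨⟨hk1, hk2⟩, hk3⟩, hk4⟩ := hk
    refine ⟨Function.update col s(u, v) k, ?_⟩
    have hnew : ∀ f ∈ E, Function.update col s(u, v) k f = col f := by
      intro f hf
      rw [Function.update_of_ne]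
      rintro rfl; exact he hf
    have hk34 : ∀ w ∈ s(u, v), ∀ f ∈ E, w ∈ f → col f ≠ k := by
      intro w hw f hf hwf
      rw [Sym2.mem_iff] at hw
      rcases hw with rfl | rfl
      · exact hk3 f hf hwf
      · exact hk4 f hf hwf
    intro f hf w hw
    rw [Finset.mem_insert] at hf
    rcases hf with rfl | hf
    · rw [Function.update_self]
      refine ⟨?_, ?_⟩
      · rw [Sym2.mem_iff] at hw
        rcases hw with rfl | rfl <;> assumption
      · intro f hf hwf hne
        rw [Finset.mem_insert] at hf
        rcases hf with rfl | hf
        · exact absurd rfl hne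
        · rw [hnew f hf]; exact (hk34 w hw f hf hwf).symm
    · rw [hnew f hf]
      refine ⟨(hcol f hf w hw).1, ?_⟩
      intro f' hf' hwf' hne
      rw [Finset.mem_insert] at hf'
      rcases hf' with rfl | hf'
      · rw [Function.update_self]; exact hk34 w hwf' f hf hw
      · rw [hnew f' hf']; exact (hcol f hf w hw).2 f' hf' hwf' hne

lemma greedy {K G P : Type*} [Fintype K] [DecidableEq K] [Fintype G] [DecidableEq G]
    [DecidableEq P] (part : G → P) [Nonempty K] (M : G → Finset K)
    (hM : ∀ u v, part u ≠ part v → ((M u).card : ℤ) + (M v).card + (Fintype.card G - psz part u)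
      + (Fintype.card G - psz part v) < Fintype.card K + 2) :
    ∃ ck : K → G → G → ℤ, (∀ k u v, 0 ≤ ck k u v) ∧ (∀ k u v, ck k u v = ck k v u) ∧
      (∀ u v, ∑ k, ck k u v = ad part u v) ∧
      (∀ k v, (if k ∈ M v then 1 else 0) + ∑ u, ck k v u ≤ 1) := by
  classical
  let H : SimpleGraph G := { Adj := fun u v => part u ≠ part v, symm := ⟨fun _ _ h => Ne.symm h⟩,
                             loopless := ⟨fun u h => h rfl⟩ }
  have hdeg : ∀ v, (H.degree v : ℤ) = Fintype.card G - psz part v := by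
    intro v
    rw [← sum_ad, ← SimpleGraph.card_neighborFinset_eq_degree, SimpleGraph.neighborFinset_eq_filter]
    rw [Finset.card_filter]
    push_cast
    apply Finset.sum_congr rfl
    intro u _
    simp only [H, ad]
    split_ifs <;> simp_all
  obtain ⟨col, hcol⟩ := greedy_aux H M (by
    intro u v huv
    have := hM u v huv
    rw [← hdeg, ← hdeg] at this
    exact_mod_cast this) H.edgeFinset subset_rfl
  refine ⟨fun k u v => if part u ≠ part v ∧ col s(u, v) = k then 1 else 0, ?_, ?_, ?_, ?_⟩
  · intro k u v; dsimp only; split_ifs <;> simp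
  · intro k u v; dsimp only; rw [Sym2.eq_swap]; simp only [ne_comm]
  · intro u v
    by_cases h : part u = part v
    · simp [ad, h]
    · simp [ad, h]
  · intro k v
    dsimp only
    have hadj : ∀ u, part v ≠ part u → s(v, u) ∈ H.edgeFinset := by
      intro u hu; rw [SimpleGraph.mem_edgeFinset]; exact hu
    by_cases hex : ∃ u, part v ≠ part u ∧ col s(v, u) = k
    · obtain ⟨u, hu, hk⟩ := hex
      have h1 := hcol _ (hadj u hu) v (by simp)
      rw [hk] at h1
      rw [if_neg h1.1, Finset.sum_eq_single u]
      · split_ifs <;> simp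
      · intro w _ hw
        rw [if_neg]
        rintro ⟨h2, h3⟩
        refine h1.2 _ (hadj w h2) (by simp) ?_ h3.symm
        intro h
        apply hw
        exact (Sym2.congr_right.1 h).symm
      · simp
    · push Not at hex
      rw [Finset.sum_eq_zero]
      · split_ifs <;> simp
      · intro u _
        rw [if_neg]
        rintro ⟨h2, h3⟩
        exact hex u h2 h3

end CMG

namespace CMG

lemma select {K G : Type*} [Fintype K] [DecidableEq K] [Fintype G] [DecidableEq G]
    (Y : K → G → ℤ) (hY0 : ∀ k v, 0 ≤ Y k v) (hY1 : ∀ k v, Y k v ≤ 1) (nS nB r s : ℤ)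
    (hYs : ∀ v, ∑ k, Y k v = nS) (F : Finset K) (hr : 0 ≤ r) (hs : 0 < s)
    (hrs : r * nS ≤ s * nB) (hF : (F.card : ℤ) < nS)
    (hmx : s * nB - F.card * r ≤ s * (nS - F.card)) :
    ∃ Z : K → G → ℤ, (∀ k v, 0 ≤ Z k v) ∧ (∀ k v, Z k v ≤ Y k v) ∧ (∀ v, ∑ k, Z k v = nB) ∧
      (∀ k ∈ F, ∀ z : ℤ, z * s ≤ r * ∑ v, Y k v → z ≤ ∑ v, Z k v) ∧
      (∀ k ∈ F, ∀ z : ℤ, r * ∑ v, Y k v ≤ z * s → ∑ v, Z k v ≤ z) ∧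
      (∀ k ∉ F, ∀ z : ℤ, z * nS ≤ nB * ∑ v, Y k v → z ≤ ∑ v, Z k v) ∧
      (∀ k ∉ F, ∀ z : ℤ, (s * nB - F.card * r) * ∑ v, Y k v ≤ z * (s * (nS - F.card)) →
        ∑ v, Z k v ≤ z) := by
  have hF0 : (0:ℤ) ≤ F.card := by positivity
  have hnS : 0 < nS := by omega
  have hnB : 0 ≤ nB := by
    by_contra h
    push Not at h
    nlinarith [mul_nonneg hr hnS.le]
  set f : G → ℤ := fun v => ∑ k ∈ F, Y k v with hf
  have hf0 : ∀ v, 0 ≤ f v := fun v => Finset.sum_nonneg fun k _ => hY0 k v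
  have hfF : ∀ v, f v ≤ F.card := by
    intro v
    have := Finset.sum_le_card_nsmul F (fun k => Y k v) 1 (fun k _ => hY1 k v)
    simpa using this
  have hfc : ∀ v, ∑ k ∈ Fᶜ, Y k v = nS - f v := by
    intro v
    rw [← hYs v, ← Finset.sum_add_sum_compl F]; simp [hf]
  set θ : ℚ := r / s with hθ
  set τ : G → ℚ := fun v => (nB - f v * θ) / (nS - f v) with hτ
  have hsq : (0:ℚ) < s := by exact_mod_cast hs
  have hnSq : (0:ℚ) < nS := by exact_mod_cast hnS
  have hnBq : (0:ℚ) ≤ nB := by exact_mod_cast hnB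
  have hθ0 : 0 ≤ θ := by rw [hθ]; have : (0:ℚ) ≤ r := by exact_mod_cast hr
                         positivity
  have hθs : θ * s = r := by rw [hθ]; field_simp
  have hθS : θ * nS ≤ nB := by
    rw [hθ, div_mul_eq_mul_div, div_le_iff₀ hsq]
    have : ((r * nS : ℤ) : ℚ) ≤ ((s * nB : ℤ) : ℚ) := by exact_mod_cast hrs
    push_cast at this; linarith
  have hfq : ∀ v, (0:ℚ) ≤ f v := fun v => by exact_mod_cast hf0 v
  have hfFq : ∀ v, (f v : ℚ) ≤ (F.card : ℚ) := fun v => by exact_mod_cast hfF v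
  have hFq : (F.card : ℚ) < nS := by exact_mod_cast hF
  have hden : ∀ v, (0:ℚ) < nS - f v := fun v => by linarith [hfFq v]
  have hτlow : ∀ v, (nB : ℚ) / nS ≤ τ v := by
    intro v
    rw [hτ, div_le_div_iff₀ hnSq (hden v)]
    nlinarith [hfq v, mul_nonneg (hfq v) (sub_nonneg.2 hθS)]
  have hτhigh : ∀ v, τ v ≤ (nB - F.card * θ) / (nS - F.card) := by
    intro v
    rw [hτ, div_le_div_iff₀ (hden v) (by linarith)]
    nlinarith [mul_nonneg (sub_nonneg.2 (hfFq v)) (sub_nonneg.2 hθS)]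
  have hmax : ((nB : ℚ) - F.card * θ) / (nS - F.card) ≤ 1 := by
    rw [div_le_one (by linarith)]
    have : ((s * nB - F.card * r : ℤ) : ℚ) ≤ ((s * (nS - F.card) : ℤ) : ℚ) := by exact_mod_cast hmx
    push_cast at this
    rw [← hθs] at this
    by_contra h
    push Not at h
    nlinarith [mul_lt_mul_of_pos_left h hsq]
  have hθ1 : θ ≤ 1 := by
    have h1 : (nB : ℚ) / nS ≤ (nB - F.card * θ) / (nS - F.card) := by
      rw [div_le_div_iff₀ hnSq (by linarith)]
      have : (0:ℚ) ≤ F.card := by positivity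
      nlinarith [mul_nonneg this (sub_nonneg.2 hθS)]
    have h2 : θ ≤ nB / nS := by rw [le_div_iff₀ hnSq]; exact hθS
    linarith
  have hτ0 : ∀ v, 0 ≤ τ v := fun v => le_trans (by positivity) (hτlow v)
  obtain ⟨Z, hZ1, hZ2, hZ3⟩ := round (fun k v => (Y k v : ℚ) * if k ∈ F then θ else τ v)
  have hxsum : ∀ v, ∑ k, (Y k v : ℚ) * (if k ∈ F then θ else τ v) = nB := by
    intro v
    rw [← Finset.sum_add_sum_compl F]
    have e1 : ∑ k ∈ F, (Y k v : ℚ) * (if k ∈ F then θ else τ v) = f v * θ := by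
      rw [hf]; push_cast; rw [Finset.sum_mul]
      exact Finset.sum_congr rfl fun k hk => by rw [if_pos hk]
    have e2 : ∑ k ∈ Fᶜ, (Y k v : ℚ) * (if k ∈ F then θ else τ v) = (nS - f v) * τ v := by
      have : ((nS - f v : ℤ) : ℚ) = ∑ k ∈ Fᶜ, (Y k v : ℚ) := by rw [← hfc]; push_cast; rfl
      push_cast at this
      rw [this, Finset.sum_mul]
      exact Finset.sum_congr rfl fun k hk => by rw [if_neg (by simpa using hk)]
    rw [e1, e2, hτ]
    have := (hden v).ne'
    field_simp
    ring
  have hw0 : ∀ k v, (0:ℚ) ≤ if k ∈ F then θ else τ v := by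
    intro k v; split_ifs; exacts [hθ0, hτ0 v]
  have hw1 : ∀ k v, (if k ∈ F then θ else τ v) ≤ (1:ℚ) := by
    intro k v; split_ifs; exacts [hθ1, (hτhigh v).trans hmax]
  have hYq : ∀ k v, (0:ℚ) ≤ Y k v := fun k v => by exact_mod_cast hY0 k v
  have hy0 : ∀ k, (0:ℚ) ≤ ∑ v, (Y k v : ℚ) := fun k => Finset.sum_nonneg fun v _ => hYq k v
  have hFrow : ∀ k ∈ F, ∑ v, (Y k v : ℚ) * (if k ∈ F then θ else τ v) = (∑ v, (Y k v : ℚ)) * θ := by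
    intro k hk; simp [hk, Finset.sum_mul]
  refine ⟨Z, ?_, ?_, ?_, ?_, ?_, ?_, ?_⟩
  · intro k v
    refine le_trans ?_ (hZ1 k v).1
    rw [Int.le_floor]
    push_cast
    exact mul_nonneg (hYq k v) (hw0 k v)
  · intro k v
    refine (hZ1 k v).2.trans ?_
    rw [Int.ceil_le]
    exact mul_le_of_le_one_right (hYq k v) (hw1 k v)
  · intro v
    have h := hZ3 v
    rw [hxsum] at h
    simp at h
    exact le_antisymm h.2 h.1
  · intro k hk z hz
    refine le_trans ?_ (hZ2 k).1
    rw [Int.le_floor, hFrow k hk]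
    have : ((z * s : ℤ) : ℚ) ≤ ((r * ∑ v, Y k v : ℤ) : ℚ) := by exact_mod_cast hz
    push_cast at this
    rw [← hθs] at this
    by_contra h
    push Not at h
    nlinarith [mul_lt_mul_of_pos_right h hsq]
  · intro k hk z hz
    refine (hZ2 k).2.trans ?_
    rw [Int.ceil_le, hFrow k hk]
    have : ((r * ∑ v, Y k v : ℤ) : ℚ) ≤ ((z * s : ℤ) : ℚ) := by exact_mod_cast hz
    push_cast at this
    rw [← hθs] at this
    by_contra h
    push Not at h
    nlinarith [mul_lt_mul_of_pos_right h hsq]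
  · intro k hk z hz
    refine le_trans ?_ (hZ2 k).1
    rw [Int.le_floor]
    have h1 : (∑ v, (Y k v : ℚ)) * (nB / nS) ≤
        ∑ v, (Y k v : ℚ) * (if k ∈ F then θ else τ v) := by
      rw [Finset.sum_mul]
      refine Finset.sum_le_sum fun v _ => mul_le_mul_of_nonneg_left ?_ (hYq k v)
      rw [if_neg hk]; exact hτlow v
    refine le_trans ?_ h1
    have : ((z * nS : ℤ) : ℚ) ≤ ((nB * ∑ v, Y k v : ℤ) : ℚ) := by exact_mod_cast hz
    push_cast at this
    rw [mul_div_assoc', le_div_iff₀ hnSq]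
    linarith
  · intro k hk z hz
    refine (hZ2 k).2.trans ?_
    rw [Int.ceil_le]
    have h1 : ∑ v, (Y k v : ℚ) * (if k ∈ F then θ else τ v) ≤
        (∑ v, (Y k v : ℚ)) * ((nB - F.card * θ) / (nS - F.card)) := by
      rw [Finset.sum_mul]
      refine Finset.sum_le_sum fun v _ => mul_le_mul_of_nonneg_left ?_ (hYq k v)
      rw [if_neg hk]; exact hτhigh v
    refine h1.trans ?_
    have : (((s * nB - F.card * r) * ∑ v, Y k v : ℤ) : ℚ) ≤
      ((z * (s * (nS - F.card)) : ℤ) : ℚ) := by exact_mod_cast hz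
    push_cast at this
    rw [mul_div_assoc', div_le_iff₀ (by linarith)]
    rw [← hθs] at this
    by_contra h
    push Not at h
    nlinarith [mul_lt_mul_of_pos_right h hsq]

end CMG

namespace CMG

lemma min_case_g {K G : Type*} [Fintype K] [Fintype G] (nA nB a : ℤ) (y d : K → ℤ)
    (Z : K → G → ℤ) (hd : ∑ k, d k = nB) (hZ : ∀ v, ∑ k, Z k v = nB)
    (hK : (Fintype.card K : ℤ) = nA + nB + Fintype.card G - a)
    (hB : 0 ≤ nB * (nB - a - 1))
    (hgh : ∀ k, nB - d k - ∑ v, Z k v ≤ nA - y k + ∑ v, Z k v) :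
    nA * nB ≤ ∑ k, min (nB - d k - ∑ v, Z k v) (nA - y k + ∑ v, Z k v) := by
  have : ∀ k, min (nB - d k - ∑ v, Z k v) (nA - y k + ∑ v, Z k v) = nB - d k - ∑ v, Z k v :=
    fun k => min_eq_left (hgh k)
  simp only [this, Finset.sum_sub_distrib, hd]
  rw [Finset.sum_comm]
  simp only [hZ, Finset.sum_const, Finset.card_univ, nsmul_eq_mul, hK]
  nlinarith

lemma sum_h {K G : Type*} [Fintype K] [Fintype G] (nA nB a : ℤ)
    (Y Z : K → G → ℤ) (hZ : ∀ v, ∑ k, Z k v = nB)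
    (hY : ∀ v, ∑ k, Y k v = nA + nB)
    (hK : (Fintype.card K : ℤ) = nA + nB + Fintype.card G - a) :
    ∑ k, (nA - ∑ v, Y k v + ∑ v, Z k v) = nA * nB + nA * (nA - a) := by
  simp only [Finset.sum_add_distrib, Finset.sum_sub_distrib]
  rw [Finset.sum_comm, Finset.sum_comm (f := Z)]
  simp only [hZ, hY, Finset.sum_const, Finset.card_univ, nsmul_eq_mul, hK]
  ring

lemma zsel_odd {K G : Type*} [Fintype K] [DecidableEq K] [Fintype G] [DecidableEq G]
    (nA nB a : ℤ) (ha : 1 ≤ a) (hnB : nB = 0 ∨ a + 1 ≤ nB)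
    (Y : K → G → ℤ) (hY0 : ∀ k v, 0 ≤ Y k v) (hY1 : ∀ k v, Y k v ≤ 1)
    (hYs : ∀ v, ∑ k, Y k v = nA + nB)
    (hK : (Fintype.card K : ℤ) = nA + nB + Fintype.card G - a)
    (hGA : (Fintype.card G : ℤ) ≤ nA - a) (F : Finset K) (hF : (F.card : ℤ) = nB)
    (hpar : ∀ k, Even (nB - nA - (if k ∈ F then 1 else 0) + ∑ v, Y k v)) :
    ∃ Z : K → G → ℤ, (∀ k v, 0 ≤ Z k v) ∧ (∀ k v, Z k v ≤ Y k v) ∧ (∀ v, ∑ k, Z k v = nB) ∧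
      (∀ k, 0 ≤ nB - (if k ∈ F then 1 else 0) - ∑ v, Z k v) ∧
      nA * nB ≤ ∑ k, min (nB - (if k ∈ F then 1 else 0) - ∑ v, Z k v)
        (nA - ∑ v, Y k v + ∑ v, Z k v) := by
  have hG0 : (0:ℤ) ≤ Fintype.card G := by positivity
  have hy0 : ∀ k, 0 ≤ ∑ v, Y k v := fun k => Finset.sum_nonneg fun v _ => hY0 k v
  have hy1 : ∀ k, ∑ v, Y k v ≤ nA - a := by
    intro k
    refine le_trans ?_ hGA
    have := Finset.sum_le_card_nsmul Finset.univ (fun v => Y k v) 1 (fun v _ => hY1 k v)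
    simpa using this
  have hdsum : ∑ k, (if k ∈ F then (1:ℤ) else 0) = nB := by simp [hF]
  have hBB : 0 ≤ nB * (nB - a - 1) := by
    rcases hnB with h | h
    · simp [h]
    · exact mul_nonneg (by linarith) (by linarith)
  rcases hnB with h0 | hB1
  · have hFe : F = ∅ := by rw [← Finset.card_eq_zero]; omega
    refine ⟨fun _ _ => 0, by simp, hY0, by simp [h0], by simp [hFe, h0], ?_⟩
    rw [h0]
    simp only [hFe, mul_zero]
    apply Finset.sum_nonneg
    intro k _
    simp
    linarith [hy1 k]
  rcases lt_trichotomy nB (nA + 1) with hlt | heq | hgt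
  · -- few vertices in parts of the second size
    obtain ⟨Z, hZ0, hZY, hZs, hl, hu, hl', hu'⟩ := select Y hY0 hY1 (nA + nB) nB (nB - 1)
      (nA + nB) hYs F (by linarith) (by linarith) (by nlinarith) (by linarith)
      (by rw [hF]; nlinarith)
    rw [hF] at hu'
    have key : ∀ k, nB - (if k ∈ F then 1 else 0) - ∑ v, Z k v ≤
        nA - ∑ v, Y k v + ∑ v, Z k v ∧ 0 ≤ nB - (if k ∈ F then 1 else 0) - ∑ v, Z k v := by
      intro k
      obtain ⟨z, hz⟩ := hpar k
      have h0 := hy0 k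
      have h1 := hy1 k
      by_cases hk : k ∈ F
      · simp only [hk, if_true] at hz ⊢
        have e1 := hl k hk z (by
          have : nA - nB ≥ 0 := by linarith
          nlinarith [mul_nonneg this (show 0 ≤ nB by linarith),
            mul_nonneg (show 0 ≤ nA - nB + 2 by linarith)
            (show 0 ≤ nA - 1 - ∑ v, Y k v by linarith)])
        have e2 := hu k hk (nB - 1) (by
          apply mul_le_mul_of_nonneg_left <;> linarith)
        constructor <;> linarith
      · simp only [hk, if_false] at hz ⊢
        have e1 := hl' k hk z (by
          nlinarith [mul_nonneg (show 0 ≤ nA - nB by linarith)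
            (show 0 ≤ nA + nB - ∑ v, Y k v by linarith)])
        have e2 := hu' k hk nB (by
          have : (nA + 1) * ∑ v, Y k v ≤ (nA + nB) * nA := by nlinarith
          nlinarith [mul_le_mul_of_nonneg_left this (show 0 ≤ nB by linarith)])
        constructor <;> linarith
    exact ⟨Z, hZ0, hZY, hZs, fun k => (key k).2,
      min_case_g nA nB a (fun k => ∑ v, Y k v) (fun k => if k ∈ F then 1 else 0) Z hdsum hZs hK hBB
        (fun k => (key k).1)⟩
  · obtain ⟨Z, hZ0, hZY, hZs, hl, hu, hl', hu'⟩ := select Y hY0 hY1 (nA + nB) nB 1 2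
      hYs F (by linarith) (by linarith) (by linarith) (by linarith)
      (by rw [hF]; linarith)
    rw [hF] at hu'
    have key : ∀ k, nA - ∑ v, Y k v + ∑ v, Z k v ≤ nB - (if k ∈ F then 1 else 0) - ∑ v, Z k v := by
      intro k
      obtain ⟨z, hz⟩ := hpar k
      have h0 := hy0 k
      have h1 := hy1 k
      by_cases hk : k ∈ F
      · simp only [hk, if_true] at hz ⊢
        have e1 := hu k hk z (by linarith)
        linarith
      · simp only [hk, if_false] at hz ⊢
        have e1 := hu' k hk z (by
          have : z * 2 = 1 + ∑ v, Y k v := by linarith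
          have e : z * (2 * (nA + nB - nB)) = z * 2 * nA := by ring
          rw [e, this, heq]; nlinarith)
        linarith
    refine ⟨Z, hZ0, hZY, hZs, ?_, ?_⟩
    · intro k
      have := Finset.sum_nonneg fun v (_ : v ∈ Finset.univ) => hZ0 k v
      linarith [key k, hy1 k]
    · rw [Finset.sum_congr rfl fun k _ => min_eq_right (key k), sum_h nA nB a Y Z hZs hYs hK]
      nlinarith
  · obtain ⟨Z, hZ0, hZY, hZs, hl, hu, hl', hu'⟩ := select Y hY0 hY1 (nA + nB) nB nB (nA + nB)
      hYs F (by linarith) (by linarith) (by linarith) (by linarith)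
      (by rw [hF]; nlinarith)
    rw [hF] at hu'
    have key : ∀ k, nA - ∑ v, Y k v + ∑ v, Z k v ≤ nB - (if k ∈ F then 1 else 0) - ∑ v, Z k v := by
      intro k
      obtain ⟨z, hz⟩ := hpar k
      have h0 := hy0 k
      have h1 := hy1 k
      by_cases hk : k ∈ F
      · simp only [hk, if_true] at hz ⊢
        have e1 := hu k hk z (by
          nlinarith [mul_nonneg (show 0 ≤ nB - nA by linarith)
            (show 0 ≤ nA - 1 - ∑ v, Y k v by linarith), mul_nonneg (show 0 ≤ nB - nA - 2 by linarith)
            (show 0 ≤ nA by linarith)])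
        linarith
      · simp only [hk, if_false] at hz ⊢
        have e1 := hu' k hk z (by
          have e : nB * ∑ v, Y k v ≤ z * (nA + nB) := by
            nlinarith [mul_nonneg (show 0 ≤ nB - nA by linarith)
              (show 0 ≤ nA + nB - ∑ v, Y k v by linarith)]
          nlinarith [mul_le_mul_of_nonneg_left e (show 0 ≤ nA by linarith)])
        linarith
    refine ⟨Z, hZ0, hZY, hZs, ?_, ?_⟩
    · intro k
      have := Finset.sum_nonneg fun v (_ : v ∈ Finset.univ) => hZ0 k v
      linarith [key k, hy1 k]
    · rw [Finset.sum_congr rfl fun k _ => min_eq_right (key k), sum_h nA nB a Y Z hZs hYs hK]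
      nlinarith

lemma zsel_even {K G : Type*} [Fintype K] [DecidableEq K] [Fintype G] [DecidableEq G]
    (nA nB a : ℤ) (ha : 2 ≤ a) (hnB : nB = 0 ∨ a + 1 ≤ nB) (hnA : 2 * a ≤ nA)
    (Y : K → G → ℤ) (hY0 : ∀ k v, 0 ≤ Y k v) (hY1 : ∀ k v, Y k v ≤ 1)
    (hYs : ∀ v, ∑ k, Y k v = nA + nB)
    (hK : (Fintype.card K : ℤ) = nA + nB + Fintype.card G - a)
    (hGA : (Fintype.card G : ℤ) ≤ nA - a) (k0 : K)
    (hpar : ∀ k, k ≠ k0 → Even (nB - nA + ∑ v, Y k v)) :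
    ∃ Z : K → G → ℤ, (∀ k v, 0 ≤ Z k v) ∧ (∀ k v, Z k v ≤ Y k v) ∧ (∀ v, ∑ k, Z k v = nB) ∧
      (∀ k, 0 ≤ nB - (if k = k0 then nB else 0) - ∑ v, Z k v) ∧
      nA * nB ≤ ∑ k, min (nB - (if k = k0 then nB else 0) - ∑ v, Z k v)
        (nA - ∑ v, Y k v + ∑ v, Z k v) := by
  have hG0 : (0:ℤ) ≤ Fintype.card G := by positivity
  have hnB0 : 0 ≤ nB := by omega
  have hy0 : ∀ k, 0 ≤ ∑ v, Y k v := fun k => Finset.sum_nonneg fun v _ => hY0 k v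
  have hy1 : ∀ k, ∑ v, Y k v ≤ nA - a := by
    intro k
    refine le_trans ?_ hGA
    have := Finset.sum_le_card_nsmul Finset.univ (fun v => Y k v) 1 (fun v _ => hY1 k v)
    simpa using this
  have hdsum : ∑ k, (if k = k0 then nB else 0) = nB := by simp
  have hBB : 0 ≤ nB * (nB - a - 1) := by
    rcases hnB with h | h
    · simp [h]
    · exact mul_nonneg (by linarith) (by linarith)
  obtain ⟨Z, hZ0, hZY, hZs, hl, hu, hl', hu'⟩ := select Y hY0 hY1 (nA + nB) nB 0 1
    hYs {k0} (by linarith) (by linarith) (by linarith) (by simp; linarith) (by simp; linarith)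
  simp only [Finset.card_singleton, Finset.mem_singleton, Nat.cast_one] at hu hl hu' hl'
  have hZk0 : ∑ v, Z k0 v = 0 :=
    le_antisymm (hu k0 rfl 0 (by simp)) (Finset.sum_nonneg fun v _ => hZ0 k0 v)
  rcases le_or_gt nB nA with hle | hgt
  · have key : ∀ k, nB - (if k = k0 then nB else 0) - ∑ v, Z k v ≤
        nA - ∑ v, Y k v + ∑ v, Z k v ∧ 0 ≤ nB - (if k = k0 then nB else 0) - ∑ v, Z k v := by
      intro k
      have h0 := hy0 k
      have h1 := hy1 k
      by_cases hk : k = k0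
      · subst hk; simp only [if_true, hZk0]; constructor <;> linarith
      · obtain ⟨z, hz⟩ := hpar k hk
        simp only [hk, if_false] at hz ⊢
        have e1 := hl' k hk z (by
          nlinarith [mul_nonneg (show 0 ≤ nA - nB by linarith)
            (show 0 ≤ nA + nB - ∑ v, Y k v by linarith)])
        have e2 := hu' k hk nB (by
          have : ∑ v, Y k v ≤ nA + nB - 1 := by linarith
          nlinarith [mul_le_mul_of_nonneg_left this (show 0 ≤ nB by linarith)])
        constructor <;> linarith
    exact ⟨Z, hZ0, hZY, hZs, fun k => (key k).2,
      min_case_g nA nB a (fun k => ∑ v, Y k v) (fun k => if k = k0 then nB else 0) Z hdsum hZs hK hBB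
        (fun k => (key k).1)⟩
  · have key : ∀ k, k ≠ k0 → nA - ∑ v, Y k v + ∑ v, Z k v ≤ nB - ∑ v, Z k v := by
      intro k hk
      obtain ⟨z, hz⟩ := hpar k hk
      have h0 := hy0 k
      have h1 := hy1 k
      have e1 := hu' k hk z (by
        nlinarith [mul_nonneg (show 0 ≤ nB - nA by linarith)
            (show 0 ≤ nA - 2 - ∑ v, Y k v by linarith)])
      linarith
    refine ⟨Z, hZ0, hZY, hZs, ?_, ?_⟩
    · intro k
      by_cases hk : k = k0
      · subst hk; simp [hZk0]
      · have := Finset.sum_nonneg fun v (_ : v ∈ Finset.univ) => hZ0 k v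
        simp only [hk, if_false]
        linarith [key k hk, hy1 k]
    · have hs := sum_h nA nB a Y Z hZs hYs hK
      have : ∑ k, ((nA - ∑ v, Y k v + ∑ v, Z k v) - if k = k0 then nA else 0) ≤
          ∑ k, min (nB - (if k = k0 then nB else 0) - ∑ v, Z k v)
            (nA - ∑ v, Y k v + ∑ v, Z k v) := by
        apply Finset.sum_le_sum
        intro k _
        by_cases hk : k = k0
        · subst hk
          simp only [if_true, hZk0]
          have := hy0 k
          have := hy1 k
          rw [le_min_iff]; constructor <;> linarith
        · simp only [hk, if_false, sub_zero]
          rw [min_eq_right (key k hk)]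
      rw [Finset.sum_sub_distrib, hs] at this
      simp at this
      nlinarith

end CMG

namespace CMG

/-- Existence of the amalgamated colouring. -/
def Out (K : Type*) {G P : Type*} [Fintype K] [Fintype G] [DecidableEq P] (part : G → P)
    (a nA nB : ℤ) : Prop :=
  ∃ c : K → G ⊕ Bool → G ⊕ Bool → ℤ,
      (∀ k x y, 0 ≤ c k x y) ∧ (∀ k x y, c k x y = c k y x) ∧ (∀ k x, Even (c k x x)) ∧
      (∀ u v, ∑ k, c k (.inl u) (.inl v) = ad part u v) ∧
      (∀ v, ∑ k, c k (.inl v) (.inr false) = nA) ∧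
      (∀ v, ∑ k, c k (.inl v) (.inr true) = nB) ∧
      (∑ k, c k (.inr false) (.inr false) = nA * (nA - a)) ∧
      (∑ k, c k (.inr false) (.inr true) = nA * nB) ∧
      (∑ k, c k (.inr true) (.inr true) = nB * (nB - (a + 1))) ∧
      (∀ k v, ∑ y, c k (.inl v) y ≤ 1) ∧
      (∀ k, ∑ y, c k (.inr false) y ≤ nA) ∧
      (∀ k, ∑ y, c k (.inr true) y ≤ nB)

lemma even_qq (a q : ℤ) : Even (q * (a + 1) * (q * (a + 1) - (a + 1))) := by
  have : q * (a + 1) * (q * (a + 1) - (a + 1)) = (q * (q - 1)) * (a + 1) ^ 2 := by ring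
  rw [this]
  exact (Int.even_mul_pred_self q).mul_right _

lemma core_wrap {K G P : Type*} [Fintype K] [DecidableEq K] [Nonempty K] [Fintype G]
    [DecidableEq G] [DecidableEq P] (part : G → P) (a nA nB q : ℤ) (ha : 1 ≤ a) (hq : 0 ≤ q)
    (hnB : nB = q * (a + 1)) (M : G → Finset K) (hMc : ∀ v, ((M v).card : ℤ) = psz part v - a)
    (d : K → ℤ) (hd0 : ∀ k, 0 ≤ d k) (hd : ∑ k, d k = nB) (hnA : a ≤ nA)
    (hK : (Fintype.card K : ℤ) = nA + nB + Fintype.card G - a)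
    (hKe : Even (Fintype.card K : ℤ)) (hGA : (Fintype.card G : ℤ) ≤ nA - a)
    (hpar : ∀ k, Even (∑ v, (if k ∈ M v then (1:ℤ) else 0) + d k - a))
    (hsel : ∀ Y : K → G → ℤ, (∀ k v, 0 ≤ Y k v) → (∀ k v, Y k v ≤ 1) →
      (∀ v, ∑ k, Y k v = nA + nB) →
      (∀ k, Even (∑ v, Y k v - Fintype.card G + ∑ v, (if k ∈ M v then (1:ℤ) else 0))) →
      ∃ Z : K → G → ℤ, (∀ k v, 0 ≤ Z k v) ∧ (∀ k v, Z k v ≤ Y k v) ∧ (∀ v, ∑ k, Z k v = nB) ∧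
        (∀ k, 0 ≤ nB - d k - ∑ v, Z k v) ∧
        nA * nB ≤ ∑ k, min (nB - d k - ∑ v, Z k v) (nA - ∑ v, Y k v + ∑ v, Z k v)) :
    Out K part a nA nB := by
  have hB : nB = 0 ∨ a + 1 ≤ nB := by
    rcases hq.eq_or_lt with h | h
    · left; rw [hnB, ← h]; ring
    · right; rw [hnB]; nlinarith
  have hG0 : (0:ℤ) ≤ Fintype.card G := by positivity
  obtain ⟨ck, hck0, hcks, hckad, hckM⟩ := greedy part M (by
    intro u v _
    rw [hMc, hMc, hK]
    have : 0 ≤ nB := by omega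
    linarith)
  have hckd : ∀ k v, ck k v v = 0 := by
    intro k v
    have h := hckad v v
    simp only [ad, if_true] at h
    exact (Finset.sum_eq_zero_iff_of_nonneg (fun k _ => hck0 k v v)).1 h k (Finset.mem_univ _)
  set m : K → G → ℤ := fun k v => if k ∈ M v then 1 else 0 with hm
  have hm0 : ∀ k v, 0 ≤ m k v := by intro k v; simp only [hm]; split_ifs <;> simp
  have hms : ∀ v, ∑ k, m k v = psz part v - a := by intro v; rw [← hMc]; simp [hm]
  have hcs : ∀ k v, 0 ≤ ∑ u, ck k v u := fun k v => Finset.sum_nonneg fun u _ => hck0 k v u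
  obtain ⟨Z, hZ0, hZY, hZs, hg, hmin⟩ := hsel (fun k v => 1 - m k v - ∑ u, ck k v u)
    (by intro k v; have := hckM k v; simp only [hm]; linarith)
    (by intro k v; linarith [hm0 k v, hcs k v])
    (by
      intro v
      simp only [Finset.sum_sub_distrib, hms]
      rw [Finset.sum_comm]
      simp only [hckad]
      rw [sum_ad]
      simp [hK])
    (by
      intro k
      have e := even_sum_sym (ck k) (hcks k) (hckd k)
      have : ∑ v, (1 - m k v - ∑ u, ck k v u) - Fintype.card G + ∑ v, (if k ∈ M v then (1:ℤ) else 0)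
          = - ∑ v, ∑ u, ck k v u := by
        simp [hm, Finset.sum_sub_distrib]
        ring
      rw [this]
      exact e.neg)
  refine base part a nA nB ck hck0 hcks hckad m hm0 hms d hd0 hd Z hZ0 hZY hZs hK hKe hpar hg
    (by linarith) hmin ?_ (by rw [hnB]; exact even_qq a q)
  rcases hB with h0 | h1
  · rw [h0, mul_zero]
    apply Finset.sum_nonpos
    intro k _
    have h1 := hg k
    have h2 := hd0 k
    have h3 := Finset.sum_nonneg fun v (_ : v ∈ Finset.univ) => hZ0 k v
    rw [h0] at h1
    have : (0 - d k - ∑ v, Z k v) = 0 := by linarith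
    rw [this]; simp
  · have : ∑ k, (nB - d k - ∑ v, Z k v) % 2 ≤ ∑ k : K, (1:ℤ) := by
      apply Finset.sum_le_sum
      intro k _
      omega
    simp only [Finset.sum_const, Finset.card_univ, nsmul_eq_mul, mul_one, hK] at this
    nlinarith [mul_nonneg (show 0 ≤ nA - 1 by linarith) (show 0 ≤ nB - 2 by linarith)]

end CMG

namespace CMG

lemma cyc {G : Type*} [DecidableEq G] (h : ℕ) (hh : 0 < h) (e : G → ℕ) (he : ∀ v, e v ≤ h)
    (s : Finset G) : ∃ M : G → Finset ℕ, (∀ v ∈ s, (M v).card = e v) ∧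
      (∀ v ∈ s, ∀ k ∈ M v, k < h) ∧
      ∀ k, ∑ v ∈ s, (if k ∈ M v then 1 else 0) =
        ((Finset.range (∑ v ∈ s, e v)).filter fun j => j % h = k).card := by
  induction s using Finset.induction_on with
  | empty => exact ⟨fun _ => ∅, by simp, by simp, by simp⟩
  | insert v s hv ih =>
    obtain ⟨M, h1, h2, h3⟩ := ih
    set N := ∑ v ∈ s, e v with hN
    have hinj : Set.InjOn (fun j => j % h) (Finset.Ico N (N + e v) : Finset ℕ) := by
      intro i hi j hj hij
      simp only [Finset.coe_Ico, Set.mem_Ico] at hi hj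
      have := he v
      dsimp only at hij
      rcases le_total i j with hle | hle
      · have : h ∣ j - i := (Nat.modEq_iff_dvd' hle).1 hij
        have := Nat.eq_zero_of_dvd_of_lt this (by omega)
        omega
      · have : h ∣ i - j := (Nat.modEq_iff_dvd' hle).1 hij.symm
        have := Nat.eq_zero_of_dvd_of_lt this (by omega)
        omega
    set I := (Finset.Ico N (N + e v)).image (fun j => j % h) with hI
    have hne : ∀ u ∈ s, u ≠ v := fun u hu huv => hv (huv ▸ hu)
    refine ⟨Function.update M v I, ?_, ?_, ?_⟩
    · intro u hu
      rcases Finset.mem_insert.1 hu with rfl | hu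
      · rw [Function.update_self, hI, Finset.card_image_of_injOn hinj]; simp
      · rw [Function.update_of_ne (hne u hu)]; exact h1 u hu
    · intro u hu k hk
      rcases Finset.mem_insert.1 hu with rfl | hu
      · rw [Function.update_self, hI, Finset.mem_image] at hk
        obtain ⟨j, _, rfl⟩ := hk
        exact Nat.mod_lt _ hh
      · rw [Function.update_of_ne (hne u hu)] at hk; exact h2 u hu k hk
    · intro k
      rw [Finset.sum_insert hv, Finset.sum_insert hv, Function.update_self]
      have e1 : ∑ u ∈ s, (if k ∈ Function.update M v I u then 1 else 0) =
          ∑ u ∈ s, (if k ∈ M u then 1 else 0) :=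
        Finset.sum_congr rfl fun u hu => by rw [Function.update_of_ne (hne u hu)]
      rw [e1, h3 k]
      have e2 : Finset.range (e v + N) = Finset.range N ∪ Finset.Ico N (N + e v) := by
        ext j; simp only [Finset.mem_range, Finset.mem_union, Finset.mem_Ico]; omega
      rw [e2, Finset.filter_union, Finset.card_union_of_disjoint, add_comm]
      · congr 1
        split_ifs with hk
        · rw [hI, Finset.mem_image] at hk
          obtain ⟨j, hj, rfl⟩ := hk
          symm
          rw [Finset.card_eq_one]
          refine ⟨j, ?_⟩
          ext i
          simp only [Finset.mem_filter, Finset.mem_singleton]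
          constructor
          · rintro ⟨hi, hij⟩
            exact hinj hi hj hij
          · rintro rfl; exact ⟨hj, rfl⟩
        · symm
          rw [Finset.card_eq_zero, Finset.filter_eq_empty_iff]
          intro j hj hjk
          exact hk (Finset.mem_image.2 ⟨j, hj, hjk⟩)
      · rw [Finset.disjoint_left]
        intro j hj hj'
        simp only [Finset.mem_filter, Finset.mem_range, Finset.mem_Ico] at hj hj'
        omega

lemma count_mod (N h k : ℕ) (hh : 0 < h) (hN1 : N ≤ 2 * h) (hN2 : 2 * h ≤ N + 1) :
    (k ≠ h - 1 → Even ((Finset.range N).filter fun j => j % h = k).card) ∧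
    (k = h - 1 → (((Finset.range N).filter fun j => j % h = k).card) % 2 = N % 2) := by
  have hm : ∀ j, j < 2 * h → (j % h = k ↔ k < h ∧ (j = k ∨ j = k + h)) := by
    intro j hj
    rcases lt_or_ge j h with h1 | h1
    · rw [Nat.mod_eq_of_lt h1]; omega
    · rw [Nat.mod_eq_sub_mod h1, Nat.mod_eq_of_lt (by omega)]; omega
  have h2 : k < h → k + h < N →
      ((Finset.range N).filter fun j => j % h = k) = {k, k + h} := by
    intro h3 h4
    ext j
    simp only [Finset.mem_filter, Finset.mem_range, Finset.mem_insert, Finset.mem_singleton]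
    constructor
    · rintro ⟨h5, h6⟩
      exact ((hm j (by omega)).1 h6).2
    · intro h5
      exact ⟨by omega, (hm j (by omega)).2 ⟨h3, h5⟩⟩
  refine ⟨?_, ?_⟩
  · intro hk
    rcases lt_or_ge k h with h3 | h3
    · rw [h2 h3 (by omega), Finset.card_pair (by omega)]; exact even_two
    · rw [Finset.filter_eq_empty_iff.2]
      · simp
      · intro j hj hjk
        rw [Finset.mem_range] at hj
        have := ((hm j (by omega)).1 hjk).1
        omega
  · intro hk
    rcases lt_or_ge (k + h) N with h3 | h3
    · rw [h2 (by omega) h3, Finset.card_pair (by omega)]; omega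
    · have : ((Finset.range N).filter fun j => j % h = k) = {k} := by
        ext j
        simp only [Finset.mem_filter, Finset.mem_range, Finset.mem_singleton]
        constructor
        · rintro ⟨h5, h6⟩
          have := ((hm j (by omega)).1 h6).2
          omega
        · intro h5
          exact ⟨by omega, (hm j (by omega)).2 ⟨by omega, by omega⟩⟩
      rw [this, Finset.card_singleton]; omega

lemma core {G P : Type*} [Fintype G] [DecidableEq G] [DecidableEq P] (part : G → P)
    (a p q T : ℕ) (ha : 1 ≤ a) (hp : 1 ≤ p) (hpsz : ∀ v, (a : ℤ) + 2 ≤ psz part v)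
    (hsum : ∑ v, (psz part v - a) = (p * a : ℤ) - a + Fintype.card G)
    (hT : (T : ℤ) = p * a + q * (a + 1) + Fintype.card G - a) (hTe : Even T) :
    Out (Fin T) part a (p * a) (q * (a + 1)) := by
  classical
  have hTZ : Even (T : ℤ) := by exact_mod_cast hTe
  have hG0 : (0:ℤ) ≤ Fintype.card G := by positivity
  have haZ : (1:ℤ) ≤ a := by exact_mod_cast ha
  have hpa : (a:ℤ) ≤ p * a := by
    have : (1:ℤ) ≤ p := by exact_mod_cast hp
    nlinarith
  have hGA : (Fintype.card G : ℤ) ≤ p * a - a := by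
    have : ∑ v : G, (2:ℤ) ≤ ∑ v, (psz part v - a) :=
      Finset.sum_le_sum fun v _ => by linarith [hpsz v]
    rw [hsum] at this
    simp at this
    linarith
  set nA : ℤ := p * a with hnA
  set nB : ℤ := q * (a + 1) with hnB
  have hnB0 : 0 ≤ nB := by positivity
  have hBcases : nB = 0 ∨ (a:ℤ) + 1 ≤ nB := by
    rcases Nat.eq_zero_or_pos q with h | h
    · left; rw [hnB, h]; simp
    · right
      have : (1:ℤ) ≤ q := by exact_mod_cast h
      rw [hnB]; nlinarith
  rcases Nat.eq_zero_or_pos T with hT0 | hT0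
  · subst hT0
    have h1 : nB = 0 := by push_cast at hT; linarith
    have h2 : nA = a := by push_cast at hT; linarith
    have h3 : Fintype.card G = 0 := by push_cast at hT; zify; linarith
    have : IsEmpty G := Fintype.card_eq_zero_iff.1 h3
    refine ⟨fun _ _ _ => 0, ?_⟩
    simp [h1, h2]
  have : Nonempty (Fin T) := ⟨⟨0, hT0⟩⟩
  have hcK : (Fintype.card (Fin T) : ℤ) = nA + nB + Fintype.card G - a := by
    rw [Fintype.card_fin]; exact hT
  have hcKe : Even (Fintype.card (Fin T) : ℤ) := by rw [Fintype.card_fin]; exact hTZ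
  have hwrap := core_wrap (K := Fin T) part a nA nB q haZ (by positivity) hnB
  have heN : ∀ v, ((psz part v - a).toNat : ℤ) = psz part v - a := fun v =>
    Int.toNat_of_nonneg (by linarith [hpsz v])
  set e : G → ℕ := fun v => (psz part v - a).toNat with he
  have hesum : ((∑ v, e v : ℕ) : ℤ) = nA - a + Fintype.card G := by
    push_cast; rw [Finset.sum_congr rfl fun v _ => heN v]; exact hsum
  rcases Nat.even_or_odd a with hae | hao
  · have haeZ : Even (a:ℤ) := by exact_mod_cast hae
    have ha2 : (2:ℤ) ≤ a := by obtain ⟨r, hr⟩ := haeZ; omega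
    rcases Nat.lt_or_ge p 2 with hp2 | hp2
    · have hp1 : p = 1 := by omega
      have hA : nA = a := by rw [hnA, hp1]; simp
      have h3 : Fintype.card G = 0 := by zify; linarith
      have hGe : IsEmpty G := Fintype.card_eq_zero_iff.1 h3
      have hTB : (T:ℤ) = nB := by rw [hT, hA, h3]; push_cast; ring
      obtain ⟨t, ht⟩ := hTe
      have hBa : (a:ℤ) + 2 ≤ nB := by
        obtain ⟨r, hr⟩ := haeZ
        omega
      refine hwrap (fun _ => ∅) (fun v => isEmptyElim v) (fun k => if k.val < t then 2 else 0)
        ?_ ?_ hpa hcK hcKe hGA ?_ ?_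
      · intro k; (try dsimp only); split_ifs <;> simp
      · rw [Fin.sum_univ_eq_sum_range (fun i => if i < t then (2:ℤ) else 0) T, ← hTB, ht,
          Finset.sum_ite]
        have : (Finset.range (t + t)).filter (fun x => x < t) = Finset.range t := by
          ext; simp; omega
        rw [this]; simp; ring
      · intro k
        try dsimp only
        rw [Finset.sum_of_isEmpty, zero_add]
        refine Even.sub ?_ haeZ
        split_ifs <;> simp
      · intro Y _ _ _ _
        refine ⟨fun _ _ => 0, fun _ v => isEmptyElim v, fun _ v => isEmptyElim v,
          fun v => isEmptyElim v, ?_, ?_⟩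
        · intro k; (try dsimp only); split_ifs <;> simp <;> linarith
        · have : ∑ k : Fin T, nA ≤ ∑ k : Fin T, min (nB - (if k.val < t then 2 else 0) - ∑ v : G, 0)
              (nA - ∑ v, Y k v + ∑ v : G, 0) := by
            apply Finset.sum_le_sum
            intro k _
            rw [le_min_iff]
            constructor
            · split_ifs <;> simp <;> linarith
            · simp
          refine le_trans (le_of_eq ?_) this
          simp [← hTB]; ring
    · have hA2 : 2 * (a:ℤ) ≤ nA := by
        have : (2:ℤ) ≤ p := by exact_mod_cast hp2
        rw [hnA]; nlinarith
      set N := ∑ v, e v with hN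
      set h := (N + 1) / 2 with hh
      have hN2 : 2 ≤ N := by zify; rw [hesum]; linarith
      have heh : ∀ v, e v ≤ h := by
        intro v
        suffices 2 * e v ≤ N by omega
        have h1 : ∑ u ∈ Finset.univ.filter (fun u => part v = part u), e u ≤ N :=
          Finset.sum_le_sum_of_subset (Finset.subset_univ _)
        have h2 : ∑ u ∈ Finset.univ.filter (fun u => part v = part u), e u =
            (Finset.univ.filter (fun u => part v = part u)).card * e v := by
          rw [← smul_eq_mul, ← Finset.sum_const]
          apply Finset.sum_congr rfl
          intro u hu
          have : part v = part u := (Finset.mem_filter.1 hu).2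
          simp only [he, psz, this]
        have h3 : 2 ≤ (Finset.univ.filter (fun u => part v = part u)).card := by
          have := hpsz v
          unfold psz at this
          omega
        calc 2 * e v ≤ _ := Nat.mul_le_mul_right _ h3
          _ ≤ N := by rw [← h2]; exact h1
      obtain ⟨M, hM1, hM2, hM3⟩ := cyc h (by omega) e heh Finset.univ
      have hTN : (T:ℤ) = N + nB := by rw [hesum, hT]; ring
      have hhT : h ≤ T := by
        have : N ≤ T := by zify; linarith
        omega
      have hMT : ∀ v, ∀ k ∈ M v, k < T := fun v k hk =>
        (hM2 v (Finset.mem_univ _) k hk).trans_le hhT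
      have hcm := fun k => count_mod N h k (by omega) (by omega) (by omega)
      set k0 : Fin T := ⟨h - 1, by omega⟩ with hk0
      have hk0i : ∀ k : Fin T, k = k0 ↔ k.val = h - 1 := fun k => by rw [Fin.ext_iff]
      have hmk : ∀ k : Fin T, ∑ v, (if k ∈ (M v).attachFin (hMT v) then (1:ℤ) else 0) =
          (((Finset.range N).filter fun j => j % h = k.val).card : ℤ) := by
        intro k
        rw [hN, ← hM3]
        push_cast
        simp [Finset.mem_attachFin]
      have hev : ∀ k : Fin T, k ≠ k0 →
          Even (∑ v, (if k ∈ (M v).attachFin (hMT v) then (1:ℤ) else 0)) := by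
        intro k hk
        rw [hmk]
        have := (hcm k.val).1 (fun h => hk ((hk0i k).2 h))
        exact_mod_cast this
      refine hwrap (fun v => (M v).attachFin (hMT v)) ?_ (fun k => if k = k0 then nB else 0)
        ?_ (by simp) hpa hcK hcKe hGA ?_ ?_
      · intro v
        rw [Finset.card_attachFin, hM1 v (Finset.mem_univ _), ← heN v]
      · intro k; (try dsimp only); split_ifs <;> simp [hnB0]
      · intro k
        try dsimp only
        by_cases hk : k = k0
        · rw [hmk, if_pos hk]
          have := (hcm k.val).2 ((hk0i k).1 hk)
          obtain ⟨r, hr⟩ := haeZ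
          obtain ⟨s, hs⟩ := hTZ
          rw [Int.even_iff]
          omega
        · rw [if_neg hk, add_zero]
          exact (hev k hk).sub haeZ
      · intro Y hY0 hY1 hYs hYe
        refine zsel_even nA nB a ha2 hBcases hA2 Y hY0 hY1 hYs hcK hGA k0 ?_
        intro k hk
        have h1 := hYe k
        have h2 := hev k hk
        obtain ⟨r, hr⟩ := haeZ
        obtain ⟨s, hs⟩ := hTZ
        obtain ⟨x, hx⟩ := h1
        obtain ⟨y, hy⟩ := h2
        rw [Int.even_iff]
        omega
  · have haoZ : Odd (a:ℤ) := by exact_mod_cast hao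
    have hcS : Fintype.card (Σ v, Fin (e v)) = ∑ v, e v := by simp
    have hcST : Fintype.card (Σ v, Fin (e v)) ≤ Fintype.card (Fin T) := by
      rw [hcS]; zify; rw [hcK]; push_cast at hesum; rw [hesum]; linarith
    obtain ⟨φ⟩ := Function.Embedding.nonempty_of_card_le hcST
    set M : G → Finset (Fin T) := fun v => Finset.univ.image fun i => φ ⟨v, i⟩ with hM
    set F : Finset (Fin T) := (Finset.univ.map φ)ᶜ with hF
    have hFc : (F.card : ℤ) = nB := by
      rw [hF, Finset.card_compl, Finset.card_map, Finset.card_univ, Nat.cast_sub hcST, hcK, hcS,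
        hesum]; ring
    have hmk : ∀ k, ∑ v, (if k ∈ M v then (1:ℤ) else 0) + (if k ∈ F then 1 else 0) = 1 := by
      intro k
      by_cases hk : k ∈ F
      · rw [if_pos hk, Finset.sum_eq_zero]
        · simp
        · intro v _
          rw [if_neg]
          intro hkv
          rw [hM, Finset.mem_image] at hkv
          obtain ⟨i, _, rfl⟩ := hkv
          rw [hF, Finset.mem_compl] at hk
          exact hk (Finset.mem_map_of_mem _ (Finset.mem_univ _))
      · rw [if_neg hk, add_zero]
        have hk' : k ∈ Finset.univ.map φ := by simpa [hF] using hk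
        obtain ⟨⟨v, i⟩, _, rfl⟩ := Finset.mem_map.1 hk'
        rw [Finset.sum_eq_single v]
        · rw [if_pos]; exact Finset.mem_image.2 ⟨i, Finset.mem_univ _, rfl⟩
        · intro u _ huv
          rw [if_neg]
          intro hku
          obtain ⟨j, _, hj⟩ := Finset.mem_image.1 hku
          have := φ.injective hj
          exact huv (congrArg Sigma.fst this)
        · simp
    refine hwrap M ?_ (fun k => if k ∈ F then 1 else 0) ?_ (by simp [hFc]) hpa hcK hcKe hGA ?_ ?_
    · intro v
      rw [hM, Finset.card_image_of_injective, Finset.card_univ, Fintype.card_fin, ← heN v]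
      intro i j hij
      have := φ.injective hij
      simpa using this
    · intro k; (try dsimp only); split_ifs <;> simp
    · intro k
      rw [hmk]
      obtain ⟨r, hr⟩ := haoZ
      rw [hr]; exact ⟨-r, by ring⟩
    · intro Y hY0 hY1 hYs hYe
      refine zsel_odd nA nB a haZ hBcases Y hY0 hY1 hYs hcK hGA F hFc ?_
      intro k
      obtain ⟨x, hx⟩ := hYe k
      have h2 := hmk k
      obtain ⟨r, hr⟩ := haoZ
      obtain ⟨s, hs⟩ := hTZ
      rw [Int.even_iff]
      omega

end CMG

namespace CMG

lemma sum_fst {ι : Type*} [Fintype ι] (V : ι → Type*) [∀ i, Fintype (V i)] (f : ι → ℤ) :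
    ∑ u : Σ i, V i, f u.1 = ∑ i, (Fintype.card (V i) : ℤ) * f i := by
  rw [Fintype.sum_sigma]
  simp

lemma card_fst {ι : Type*} [Fintype ι] [DecidableEq ι] (V : ι → Type*) [∀ i, Fintype (V i)]
    (i : ι) : ((Finset.univ.filter fun u : Σ i, V i => u.1 = i).card : ℤ) = Fintype.card (V i) := by
  have := sum_fst V (fun j => if j = i then 1 else 0)
  simpa using this

lemma final_colour {U K : Type*} [Fintype U] [DecidableEq U] [Fintype K] (H : SimpleGraph U)
    (C : K → U → U → ℤ) (h0 : ∀ k u v, 0 ≤ C k u v) (hs : ∀ k u v, C k u v = C k v u)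
    (h1 : ∀ u v, H.Adj u v → ∑ k, C k u v = 1) (hd : ∀ k u, ∑ v, C k u v ≤ 1) :
    ∃ c : H.edgeSet → K, ∀ e f : H.edgeSet, e ≠ f →
      (∃ v, v ∈ (e : Sym2 U) ∧ v ∈ (f : Sym2 U)) → c e ≠ c f := by
  have hex : ∀ e : H.edgeSet, ∃ k, ∀ u v, s(u, v) = (e : Sym2 U) → 0 < C k u v := by
    rintro ⟨e, he⟩
    induction e using Sym2.ind with
    | _ x y =>
    have hxy : H.Adj x y := he
    obtain ⟨k, hk⟩ : ∃ k, 0 < C k x y := by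
      by_contra! h
      have := Finset.sum_nonpos fun k (_ : k ∈ Finset.univ) => h k
      rw [h1 x y hxy] at this
      omega
    refine ⟨k, ?_⟩
    intro u v huv
    simp only [Sym2.eq_iff] at huv
    rcases huv with ⟨rfl, rfl⟩ | ⟨rfl, rfl⟩
    · exact hk
    · rw [hs]; exact hk
  choose c hc using hex
  refine ⟨c, ?_⟩
  rintro e f hef ⟨v, hve, hvf⟩ hcc
  obtain ⟨x, hx⟩ := Sym2.mem_iff_exists.1 hve
  obtain ⟨y, hy⟩ := Sym2.mem_iff_exists.1 hvf
  have hxy : x ≠ y := by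
    rintro rfl
    exact hef (Subtype.ext (hx.trans hy.symm))
  have e1 := hc e v x hx.symm
  have e2 := hc f v y hy.symm
  rw [hcc] at e1
  have : C (c f) v x + C (c f) v y ≤ ∑ w, C (c f) v w := by
    rw [← Finset.sum_pair hxy]
    exact Finset.sum_le_sum_of_subset_of_nonneg (Finset.subset_univ _) fun w _ _ => h0 _ _ _
  have := hd (c f) v
  omega

end CMG

namespace CMG

/-- Weight of an amalgamated vertex. -/
def wt {G : Type*} (a : ℤ) : G ⊕ Bool → ℤ
  | .inl _ => 1
  | .inr false => a
  | .inr true => a + 1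

/-- Multiplicities in the first detachment. -/
def lamA {G P : Type*} [DecidableEq P] (part : G → P) (a : ℤ) : G ⊕ Bool → G ⊕ Bool → ℤ
  | .inl u, .inl v => ad part u v
  | x, y => wt a x * wt a y

/-- Multiplicities in the second detachment. -/
def lamB {G P J : Type*} [DecidableEq P] [DecidableEq J] (part : G → P) : G ⊕ J → G ⊕ J → ℤ
  | .inl u, .inl v => ad part u v
  | .inr i, .inr j => if i = j then 0 else 1
  | .inl _, .inr _ => 1
  | .inr _, .inl _ => 1

lemma ad_comm {G P : Type*} [DecidableEq P] (part : G → P) (u v : G) :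
    ad part u v = ad part v u := by
  unfold ad; simp only [eq_comm]

lemma assemble {K G P J U : Type*} [Fintype K] [DecidableEq K] [Fintype G] [DecidableEq G]
    [DecidableEq P] [Fintype J] [DecidableEq J] [Fintype U] [DecidableEq U]
    (part : G → P) (kind : J → Bool) (a p q : ℤ)
    (hp : p = (Finset.univ.filter fun j => kind j = false).card)
    (hq : q = (Finset.univ.filter fun j => kind j = true).card)
    (hout : Out K part a (p * a) (q * (a + 1)))
    (φ : U → G ⊕ J) (hφ1 : ∀ v, (Finset.univ.filter fun u => φ u = .inl v).card = 1)
    (hφ2 : ∀ j, ((Finset.univ.filter fun u => φ u = .inr j).card : ℤ) =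
      wt (G := G) a (.inr (kind j))) :
    ∃ C : K → U → U → ℤ, (∀ k u v, 0 ≤ C k u v) ∧ (∀ k u v, C k u v = C k v u) ∧
        (∀ u v, u ≠ v → ∑ k, C k u v = lamB part (φ u) (φ v)) ∧
        (∀ k u, ∑ v, C k u v ≤ 1) := by
  classical
  obtain ⟨c, h0, hs, he, hGG, hGA, hGB, hAA, hAB, hBB, dG, dA, dB⟩ := hout
  let ψ : G ⊕ J → G ⊕ Bool := Sum.map id kind
  let η : G ⊕ Bool → ℤ
    | .inl _ => 1
    | .inr false => p
    | .inr true => q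
  obtain ⟨C1, c0, cs, cd, cl, cdeg⟩ := detach _ ψ η (lamA part a) (wt a) c rfl
    (by
      rintro (v | b)
      · have : (Finset.univ.filter fun u => ψ u = .inl v) = {Sum.inl v} := by
          ext x; rcases x with x | x <;> simp [ψ]
        rw [this]; simp [η]
      · have : (Finset.univ.filter fun u => ψ u = .inr b) =
            (Finset.univ.filter fun j => kind j = b).map Function.Embedding.inr := by
          ext x; rcases x with x | x <;> simp [ψ]
        rw [this, Finset.card_map]
        cases b
        · exact hp
        · exact hq)
    h0 hs
    (by
      rintro (u | b) (v | b') <;> simp only [lamA]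
      · exact ad_comm part u v
      · ring
      · ring
      · ring)
    (by
      rintro (u | b) (v | b') hne
      · simp [η, lamA, hGG]
      · cases b'
        · simp [η, lamA, wt, hGA]; ring
        · simp [η, lamA, wt, hGB]; ring
      · simp only [hs _ (Sum.inr b) _]
        cases b
        · simp [η, lamA, wt, hGA]
        · simp [η, lamA, wt, hGB]
      · cases b <;> cases b'
        · exact absurd rfl hne
        · simp [η, lamA, wt, hAB]; ring
        · simp only [hs _ (Sum.inr true) _]
          simp [η, lamA, wt, hAB]; ring
        · exact absurd rfl hne)
    (by
      rintro (u | b)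
      · simp [η, lamA, hGG, ad]
      · cases b
        · simp [η, lamA, wt, hAA]; ring
        · simp [η, lamA, wt, hBB]; ring)
    he
    (by
      rintro k (u | b)
      · simpa [η, wt] using dG k u
      · cases b
        · simpa [η, wt] using dA k
        · simpa [η, wt] using dB k)
  obtain ⟨C, e0, es, ed, el, edeg⟩ := detach _ φ (fun x => wt a (ψ x)) (lamB part) (fun _ => 1) C1 rfl
    (by
      rintro (v | j)
      · rw [hφ1]; simp [ψ, wt]
      · rw [hφ2]; simp [ψ])
    c0 cs
    (by
      rintro (u | i) (v | j) <;> simp only [lamB]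
      · exact ad_comm part u v
      · simp only [eq_comm])
    (by
      rintro (u | i) (v | j) hne <;> rw [cl _ _ hne]
      · simp [ψ, lamA, lamB, wt]
      · simp [ψ, lamA, lamB]
      · simp [ψ, lamA, lamB]
      · have : i ≠ j := fun h => hne (by rw [h])
        simp [ψ, lamA, lamB, this])
    (by
      intro x
      simp only [cd, Finset.sum_const_zero]
      rcases x with u | i <;> simp [lamB, ad])
    (by simp [cd])
    (by intro k x; rw [mul_one]; exact cdeg k x)
  exact ⟨C, e0, es, el, edeg⟩

lemma exists_col {ι : Type*} [Fintype ι] [DecidableEq ι] (V : ι → Type*)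
    [∀ i, Fintype (V i)] [∀ i, DecidableEq (V i)] (a T : ℕ) (ha : 1 ≤ a)
    (hmin : ∀ i, a ≤ Fintype.card (V i)) (hex : ∃ i, Fintype.card (V i) = a)
    (hT : (T : ℤ) = Fintype.card (Σ i, V i) - a) (hTe : Even T)
    (hsum : ∑ u : Σ i, V i, ((Fintype.card (V u.1) : ℤ) - a) = T) :
    ∃ c : (SimpleGraph.completeMultipartiteGraph V).edgeSet → Fin T,
      ∀ e f : (SimpleGraph.completeMultipartiteGraph V).edgeSet, e ≠ f →
        (∃ v, v ∈ (e : Sym2 (Σ i, V i)) ∧ v ∈ (f : Sym2 (Σ i, V i))) → c e ≠ c f := by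
  classical
  let s : ι → ℕ := fun i => Fintype.card (V i)
  let G := {u : Σ i, V i // a + 2 ≤ s u.1}
  let J := {i : ι // s i ≤ a + 1}
  let part : G → ι := fun v => v.1.1
  let kind : J → Bool := fun j => decide (s j.1 = a + 1)
  let p : ℕ := (Finset.univ.filter fun i => s i = a).card
  let q : ℕ := (Finset.univ.filter fun i => s i = a + 1).card
  have hpsz : ∀ v : G, psz part v = s v.1.1 := by
    intro v
    rw [← card_fst V v.1.1]
    unfold psz
    norm_cast
    rw [← Finset.card_map (Function.Embedding.subtype _)]
    congr 1
    ext u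
    simp only [Finset.mem_map, Finset.mem_filter, Finset.mem_univ, true_and,
      Function.Embedding.coe_subtype]
    constructor
    · rintro ⟨w, hw, rfl⟩; exact hw.symm
    · intro hu
      exact ⟨⟨u, by rw [hu]; exact v.2⟩, hu.symm, rfl⟩
  have hsumG : ∀ f : ι → ℤ, ∑ v : G, f v.1.1 = ∑ i, if a + 2 ≤ s i then (s i : ℤ) * f i else 0 := by
    intro f
    have h1 := sum_fst V (fun i => if a + 2 ≤ s i then f i else 0)
    have h2 : ∑ v : G, f v.1.1 = ∑ u : Σ i, V i, (if a + 2 ≤ s u.1 then f u.1 else 0) := by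
      rw [← Finset.sum_filter]
      exact (Finset.sum_subtype _ (by simp) (fun u : Σ i, V i => f u.1)).symm
    rw [h2, h1]
    apply Finset.sum_congr rfl
    intro i _
    split_ifs <;> simp [s]
  have hsplit : ∀ f : ι → ℤ, ∑ u : Σ i, V i, f u.1 = ∑ v : G, f v.1.1 +
      (∑ i ∈ Finset.univ.filter (fun i => s i = a), (a : ℤ) * f i +
      ∑ i ∈ Finset.univ.filter (fun i => s i = a + 1), ((a : ℤ) + 1) * f i) := by
    intro f
    rw [sum_fst, hsumG, Finset.sum_filter, Finset.sum_filter, ← Finset.sum_add_distrib,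
      ← Finset.sum_add_distrib]
    apply Finset.sum_congr rfl
    intro i _
    change (s i : ℤ) * f i = _
    have h1 : a ≤ s i := hmin i
    rcases (by omega : s i = a ∨ s i = a + 1 ∨ a + 2 ≤ s i) with h | h | h
    · simp [h]
    · simp [h]
    · have e1 : s i ≠ a := by omega
      have e2 : s i ≠ a + 1 := by omega
      simp [h, e1, e2]
  have hn : (Fintype.card (Σ i, V i) : ℤ) = Fintype.card G + (p * a + q * (a + 1)) := by
    have := hsplit (fun _ => 1)
    simp only [Finset.sum_const, Finset.card_univ, nsmul_eq_mul, mul_one] at this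
    exact this
  have hs2 : ∑ v : G, ((s v.1.1 : ℤ) - a) + q * (a + 1) = T := by
    rw [← hsum, hsplit (fun i => (s i : ℤ) - a)]
    have e1 : ∑ i ∈ Finset.univ.filter (fun i => s i = a), (a : ℤ) * ((s i : ℤ) - a) = 0 := by
      apply Finset.sum_eq_zero
      intro i hi
      rw [(Finset.mem_filter.1 hi).2]; simp
    have e2 : ∑ i ∈ Finset.univ.filter (fun i => s i = a + 1), ((a : ℤ) + 1) * ((s i : ℤ) - a) =
        q * (a + 1) := by
      rw [Finset.sum_congr rfl (g := fun _ => (a : ℤ) + 1)]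
      · rw [Finset.sum_const, nsmul_eq_mul]
      · intro i hi
        rw [(Finset.mem_filter.1 hi).2]; push_cast; ring
    rw [e1, e2, zero_add]
  have hp1 : 1 ≤ p := by
    obtain ⟨i, hi⟩ := hex
    exact Finset.card_pos.2 ⟨i, by simpa [s] using hi⟩
  have hout : Out (Fin T) part a (p * a) (q * (a + 1)) := by
    apply core part a p q T ha hp1
    · intro v; rw [hpsz]; have := v.2; exact_mod_cast this
    · simp only [hpsz]; linarith
    · linarith
    · exact hTe
  let φ : (Σ i, V i) → G ⊕ J := fun u =>
    if h : a + 2 ≤ s u.1 then .inl ⟨u, h⟩ else .inr ⟨u.1, by omega⟩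
  have hφl : ∀ (u : Σ i, V i) (h : a + 2 ≤ s u.1), φ u = .inl ⟨u, h⟩ := fun u h => dif_pos h
  have hφr : ∀ (u : Σ i, V i) (h : s u.1 ≤ a + 1), φ u = .inr ⟨u.1, h⟩ := fun u h =>
    dif_neg (by omega)
  obtain ⟨C, h0, hs, hl, hd⟩ := assemble part kind a p q
    (by
      norm_cast
      rw [← Finset.card_map (Function.Embedding.subtype _)]
      refine congrArg Finset.card (?_ : (Finset.univ.filter fun i => s i = a) = _)
      ext i
      simp only [Finset.mem_map, Finset.mem_filter, Finset.mem_univ, true_and,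
        Function.Embedding.coe_subtype]
      constructor
      · intro hi
        exact ⟨⟨i, by omega⟩, by simp [kind]; omega, rfl⟩
      · rintro ⟨w, hw, rfl⟩
        simp only [kind, decide_eq_false_iff_not] at hw
        have h1 : a ≤ s w.1 := hmin w.1
        have h2 := w.2
        change s w.1 = a
        omega)
    (by
      norm_cast
      rw [← Finset.card_map (Function.Embedding.subtype _)]
      refine congrArg Finset.card (?_ : (Finset.univ.filter fun i => s i = a + 1) = _)
      ext i
      simp only [Finset.mem_map, Finset.mem_filter, Finset.mem_univ, true_and,
        Function.Embedding.coe_subtype]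
      constructor
      · intro hi
        exact ⟨⟨i, by omega⟩, by simp [kind]; omega, rfl⟩
      · rintro ⟨w, hw, rfl⟩
        simpa only [kind, decide_eq_true_iff] using hw)
    hout φ
    (by
      intro v
      rw [Finset.card_eq_one]
      refine ⟨v.1, ?_⟩
      ext u
      simp only [Finset.mem_filter, Finset.mem_univ, true_and, Finset.mem_singleton]
      constructor
      · intro hu
        by_cases h : a + 2 ≤ s u.1
        · rw [hφl u h] at hu
          rw [← Sum.inl.inj hu]
        · rw [hφr u (by omega)] at hu
          cases hu
      · rintro rfl; exact hφl v.1 v.2)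
    (by
      intro j
      have h1 : a ≤ s j.1 := hmin j.1
      have h2 : s j.1 ≤ a + 1 := j.2
      have e1 : (Finset.univ.filter fun u => φ u = .inr j) =
          Finset.univ.filter fun u : Σ i, V i => u.1 = j.1 := by
        ext u
        simp only [Finset.mem_filter, Finset.mem_univ, true_and]
        by_cases h : a + 2 ≤ s u.1
        · rw [hφl u h]
          constructor
          · intro h; cases h
          · intro hu; rw [hu] at h; omega
        · rw [hφr u (by omega)]
          constructor
          · intro h; rw [← Sum.inr.inj h]
          · intro hu; congr 1; exact Subtype.ext hu
      rw [e1, card_fst V j.1]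
      change (s j.1 : ℤ) = _
      by_cases h : s j.1 = a + 1
      · simp [kind, h, wt]
      · have : s j.1 = a := by omega
        simp [kind, this, wt])
  refine final_colour _ C h0 hs ?_ hd
  intro u v huv
  have huv1 : u.1 ≠ v.1 := huv
  rw [hl u v huv.ne]
  by_cases hu : a + 2 ≤ s u.1 <;> by_cases hv : a + 2 ≤ s v.1
  · rw [hφl u hu, hφl v hv]; simp [lamB, ad, part, huv1]
  · rw [hφl u hu, hφr v (by omega)]; simp [lamB]
  · rw [hφl v hv, hφr u (by omega)]; simp [lamB]
  · rw [hφr u (by omega), hφr v (by omega)]; simp [lamB]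
    intro h; exact huv1 (congrArg Subtype.val h)

end CMG

open SimpleGraph

theorem admissible_completeMultipartite_chromatic_index
    {ι : Type*} [Fintype ι] [DecidableEq ι] (V : ι → Type*)
    [∀ i, Fintype (V i)] [∀ i, DecidableEq (V i)] [∀ i, Nonempty (V i)]
    (n m t : ℕ) (hn : n = Fintype.card (Σ i, V i))
    (hm : m = (completeMultipartiteGraph V).edgeFinset.card)
    (h1 : 1 < n)
    (hdvd : (n - 1) ∣ m)
    (hmax : (completeMultipartiteGraph V).maxDegree ≤ 2 * m / (n - 1))
    (ht : t = m / (n - 1))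
    (hnc : completeMultipartiteGraph V ≠ ⊤) :
    -- K has a proper edge colouring with 2t colours
    (∃ c : (completeMultipartiteGraph V).edgeSet → Fin (2 * t),
      ∀ e f : (completeMultipartiteGraph V).edgeSet, e ≠ f →
        (∃ v, v ∈ (e : Sym2 (Σ i, V i)) ∧ v ∈ (f : Sym2 (Σ i, V i))) → c e ≠ c f) ∧
    -- in particular the chromatic index equals the maximum degree 2t
    (completeMultipartiteGraph V).maxDegree = 2 * t ∧
    (∀ k : ℕ,
      (∃ c : (completeMultipartiteGraph V).edgeSet → Fin k,
        ∀ e f : (completeMultipartiteGraph V).edgeSet, e ≠ f →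
          (∃ v, v ∈ (e : Sym2 (Σ i, V i)) ∧ v ∈ (f : Sym2 (Σ i, V i))) → c e ≠ c f) →
      2 * t ≤ k) := by
  classical
  have hdeg : ∀ u : Σ i, V i, ((completeMultipartiteGraph V).degree u : ℤ) =
      n - Fintype.card (V u.1) := by
    intro u
    have h2 := CMG.card_fst V u.1
    have h3 : (completeMultipartiteGraph V).neighborFinset u =
        (Finset.univ.filter fun w : Σ i, V i => w.1 = u.1)ᶜ := by
      ext w
      simp only [mem_neighborFinset, Finset.mem_compl, Finset.mem_filter, Finset.mem_univ, true_and]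
      change u.1 ≠ w.1 ↔ _
      exact ne_comm
    rw [← card_neighborFinset_eq_degree, h3, Finset.card_compl,
      Nat.cast_sub (Finset.card_le_univ _), h2, ← hn]
  have hm2 : m = t * (n - 1) := by rw [ht]; exact (Nat.div_mul_cancel hdvd).symm
  have hmax2 : (completeMultipartiteGraph V).maxDegree ≤ 2 * t := by
    have : 2 * m / (n - 1) = 2 * t := by
      rw [hm2, ← mul_assoc]; exact Nat.mul_div_cancel _ (by omega)
    omega
  have hsumdeg : ∑ u : Σ i, V i, ((n : ℤ) - Fintype.card (V u.1)) = 2 * t * (n - 1) := by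
    have h2 := (completeMultipartiteGraph V).sum_degrees_eq_twice_card_edges
    rw [← hm, hm2] at h2
    have h3 : ((∑ u, (completeMultipartiteGraph V).degree u : ℕ) : ℤ) =
      ((2 * (t * (n - 1)) : ℕ) : ℤ) := by rw [h2]
    push_cast [Nat.cast_sub h1.le] at h3
    simp only [hdeg] at h3
    rw [h3]; ring
  have hne : (Finset.univ : Finset ι).Nonempty := by
    have : 0 < Fintype.card (Σ i, V i) := by omega
    obtain ⟨u⟩ := Fintype.card_pos_iff.1 this
    exact ⟨u.1, Finset.mem_univ _⟩
  obtain ⟨i0, _, hi0⟩ := Finset.exists_min_image Finset.univ (fun i => Fintype.card (V i)) hne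
  set a : ℕ := Fintype.card (V i0) with ha
  have hmin : ∀ i, a ≤ Fintype.card (V i) := fun i => hi0 i (Finset.mem_univ _)
  have ha1 : 1 ≤ a := Fintype.card_pos
  obtain ⟨x0⟩ : Nonempty (V i0) := inferInstance
  let u0 : Σ i, V i := ⟨i0, x0⟩
  have hdu0 : ((completeMultipartiteGraph V).degree u0 : ℤ) = n - a := hdeg u0
  have hdle : (completeMultipartiteGraph V).degree u0 ≤ 2 * t :=
    (degree_le_maxDegree _ u0).trans hmax2
  have hnat : (n : ℤ) - a ≤ 2 * t := by rw [← hdu0]; exact_mod_cast hdle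
  have hsub : ∀ b : ℤ, ∑ u : Σ i, V i, ((Fintype.card (V u.1) : ℤ) - b) =
      n * (n - b) - 2 * t * (n - 1) := by
    intro b
    rw [← hsumdeg]
    have : ∀ u : Σ i, V i, (Fintype.card (V u.1) : ℤ) - b =
      (n - b) - (n - Fintype.card (V u.1)) := fun u => by ring
    rw [Finset.sum_congr rfl fun u _ => this u, Finset.sum_sub_distrib, Finset.sum_const,
      Finset.card_univ, ← hn, nsmul_eq_mul]
  have hn1 : (1 : ℤ) < n := by exact_mod_cast h1
  have heq : (n : ℤ) - a = 2 * t := by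
    by_contra hcon
    have hlt : (n : ℤ) - a + 1 ≤ 2 * t := by omega
    have hnn : 0 ≤ ∑ u : Σ i, V i, ((Fintype.card (V u.1) : ℤ) - a) :=
      Finset.sum_nonneg fun u _ => by have := hmin u.1; omega
    rw [hsub] at hnn
    have haz : (a : ℤ) = 1 := by
      have : (1 : ℤ) ≤ a := by exact_mod_cast ha1
      nlinarith [mul_le_mul_of_nonneg_right hlt (show (0 : ℤ) ≤ n - 1 by linarith)]
    have hz : ∑ u : Σ i, V i, ((Fintype.card (V u.1) : ℤ) - 1) ≤ 0 := by
      rw [hsub, haz] at *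
      nlinarith [mul_le_mul_of_nonneg_right hlt (show (0 : ℤ) ≤ n - 1 by linarith)]
    have hpos : ∀ u ∈ (Finset.univ : Finset (Σ i, V i)), 0 ≤ (Fintype.card (V u.1) : ℤ) - 1 :=
      fun u _ => by have := hmin u.1; omega
    have hone := (Finset.sum_eq_zero_iff_of_nonneg hpos).1
      (le_antisymm hz (Finset.sum_nonneg hpos))
    apply hnc
    ext u v
    rw [top_adj]
    change u.1 ≠ v.1 ↔ u ≠ v
    constructor
    · intro h huv; exact h (congrArg Sigma.fst huv)
    · intro h huv
      apply h
      obtain ⟨i, x⟩ := u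
      obtain ⟨j, y⟩ := v
      dsimp only at huv
      subst huv
      have h5 := hone ⟨i, x⟩ (Finset.mem_univ _)
      have h6 : Fintype.card (V i) ≤ 1 := by dsimp only at h5; omega
      have := Fintype.card_le_one_iff.1 h6 x y
      rw [this]
  have hdeq : (completeMultipartiteGraph V).degree u0 = 2 * t := by
    zify; rw [hdu0, heq]
  refine ⟨?_, ?_, ?_⟩
  · refine CMG.exists_col V a (2 * t) ha1 hmin ⟨i0, rfl⟩ ?_ (even_two_mul t) ?_
    · push_cast; rw [← hn, heq]
    · rw [hsub]; push_cast; rw [← heq]; ring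
  · exact le_antisymm hmax2 (hdeq ▸ degree_le_maxDegree _ u0)
  · rintro k ⟨c, hc⟩
    rw [← hdeq, ← card_incidenceFinset_eq_degree]
    have hmem : ∀ e : (completeMultipartiteGraph V).incidenceFinset u0,
        e.1 ∈ (completeMultipartiteGraph V).incidenceSet u0 := fun e => by
      simpa only [mem_incidenceFinset] using e.2
    have hinj : Function.Injective
        (fun e : (completeMultipartiteGraph V).incidenceFinset u0 => c ⟨e.1, (hmem e).1⟩) := by
      intro e f hef
      by_contra hne
      refine hc _ _ ?_ ⟨u0, (hmem e).2, (hmem f).2⟩ hef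
      intro h
      exact hne (Subtype.ext (Subtype.mk.inj h))
    have := Fintype.card_le_of_injective _ hinj
    rw [Fintype.card_coe, Fintype.card_fin] at this
    exact this
end
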